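/- Let (f,g,ρ) be a warped Berger solution of Ricci flow on S^1×S^3 defined on [0,T) satisfying Assumption B. Then for every sufficiently small δ ∈ (0,1) there exist t_δ ∈ [0,T) and a constant C < ∞ such that at every point (ξ,t) with t_δ < t < T, f(ξ,t) ≤ δ, and f_{ss}(ξ,t) ≥ 0 (the neck-like region, where κ_{01} ≤ 0), the scale-invariant curvature quantities satisfy (T−t)·|κ_{01}(ξ,t)| ≤ C/|log(T−t)| and (T−t)·|κ_{02}(ξ,t)| ≤ C/|log(T−t)|. -/

import Mathlib

open Real Set Filter Topology

noncomputable section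

/-- Partial derivative in the first (spatial, `ξ`) variable. -/
def pd1 (φ : ℝ → ℝ → ℝ) (ξ t : ℝ) : ℝ := deriv (fun x => φ x t) ξ

/-- Partial derivative in the second (time) variable: `φ_t`. -/
def pdt (φ : ℝ → ℝ → ℝ) (ξ t : ℝ) : ℝ := deriv (fun τ => φ ξ τ) t

/-- Derivative with respect to arclength `s` (where `ds = ρ dξ`): `φ_s := ρ⁻¹ ∂_ξ φ`. -/
def Ds (ρ φ : ℝ → ℝ → ℝ) (ξ t : ℝ) : ℝ := pd1 φ ξ t / ρ ξ t

/-- Sectional curvature `κ₁₂ = κ₃₁ = f²/g⁴ − f_s g_s/(f g)`. -/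
def k12 (ρ f g : ℝ → ℝ → ℝ) (ξ t : ℝ) : ℝ :=
  (f ξ t) ^ 2 / (g ξ t) ^ 4 - Ds ρ f ξ t * Ds ρ g ξ t / (f ξ t * g ξ t)

/-- Sectional curvature `κ₃₁ = κ₁₂`. -/
def k31 (ρ f g : ℝ → ℝ → ℝ) (ξ t : ℝ) : ℝ :=
  (f ξ t) ^ 2 / (g ξ t) ^ 4 - Ds ρ f ξ t * Ds ρ g ξ t / (f ξ t * g ξ t)

/-- Sectional curvature `κ₂₃ = (4g² − 3f²)/g⁴ − g_s²/g²`. -/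
def k23 (ρ f g : ℝ → ℝ → ℝ) (ξ t : ℝ) : ℝ :=
  (4 * (g ξ t) ^ 2 - 3 * (f ξ t) ^ 2) / (g ξ t) ^ 4 - (Ds ρ g ξ t) ^ 2 / (g ξ t) ^ 2

/-- Sectional curvature `κ₀₁ = −f_ss/f`. -/
def k01 (ρ f : ℝ → ℝ → ℝ) (ξ t : ℝ) : ℝ := -(Ds ρ (Ds ρ f) ξ t) / f ξ t

/-- Sectional curvature `κ₀₂ = κ₀₃ = −g_ss/g`. -/
def k02 (ρ g : ℝ → ℝ → ℝ) (ξ t : ℝ) : ℝ := -(Ds ρ (Ds ρ g) ξ t) / g ξ t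

/-- Scalar curvature `R = κ₀₁ + 2κ₀₂ + 2κ₁₂ + κ₂₃`. -/
def scalR (ρ f g : ℝ → ℝ → ℝ) (ξ t : ℝ) : ℝ :=
  k01 ρ f ξ t + 2 * k02 ρ g ξ t + 2 * k12 ρ f g ξ t + k23 ρ f g ξ t

/-- `M(ξ,t) := min {f(ξ,t), g(ξ,t)}`. -/
def M (f g : ℝ → ℝ → ℝ) (ξ t : ℝ) : ℝ := min (f ξ t) (g ξ t)

/-- `M̌(t) := min_{ξ ∈ S¹} M(ξ,t)`. -/
def Mcheck (f g : ℝ → ℝ → ℝ) (t : ℝ) : ℝ := ⨅ ξ : ℝ, M f g ξ t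

/-- A warped Berger solution of Ricci flow on `S¹ × S³` with (finite) existence time `T`:
smooth positive `2π`-periodic-in-`ξ` functions `f, g, ρ` on `S¹ × [0,T)` satisfying
  `f_t = f_ss + 2 (g_s/g) f_s − 2 f³/g⁴`,
  `g_t = g_ss + (f_s/f + g_s/g) g_s + 2 (f² − 2g²)/g³`,
  `(log ρ)_t = f_ss/f + 2 g_ss/g`. -/
structure WarpedBerger (T : ℝ) (f g ρ : ℝ → ℝ → ℝ) : Prop where
  T_pos : 0 < T
  f_pos : ∀ ξ t : ℝ, 0 ≤ t → t < T → 0 < f ξ t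
  g_pos : ∀ ξ t : ℝ, 0 ≤ t → t < T → 0 < g ξ t
  ρ_pos : ∀ ξ t : ℝ, 0 ≤ t → t < T → 0 < ρ ξ t
  f_per : ∀ ξ t : ℝ, f (ξ + 2 * π) t = f ξ t
  g_per : ∀ ξ t : ℝ, g (ξ + 2 * π) t = g ξ t
  ρ_per : ∀ ξ t : ℝ, ρ (ξ + 2 * π) t = ρ ξ t
  smooth : ContDiffOn ℝ (⊤ : ℕ∞)
      (fun p : ℝ × ℝ => (f p.1 p.2, g p.1 p.2, ρ p.1 p.2)) (Set.univ ×ˢ Set.Ico 0 T)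
  eq_f : ∀ ξ t : ℝ, 0 < t → t < T →
    pdt f ξ t = Ds ρ (Ds ρ f) ξ t + 2 * (Ds ρ g ξ t / g ξ t) * Ds ρ f ξ t
      - 2 * (f ξ t) ^ 3 / (g ξ t) ^ 4
  eq_g : ∀ ξ t : ℝ, 0 < t → t < T →
    pdt g ξ t = Ds ρ (Ds ρ g) ξ t
      + (Ds ρ f ξ t / f ξ t + Ds ρ g ξ t / g ξ t) * Ds ρ g ξ t
      + 2 * ((f ξ t) ^ 2 - 2 * (g ξ t) ^ 2) / (g ξ t) ^ 3
  eq_ρ : ∀ ξ t : ℝ, 0 < t → t < T →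
    pdt (fun x τ => Real.log (ρ x τ)) ξ t
      = Ds ρ (Ds ρ f) ξ t / f ξ t + 2 * (Ds ρ (Ds ρ g) ξ t / g ξ t)

/-- The Ricci curvature blows up as `t ↗ T`:
`limsup_{t↗T} max_ξ (|κ₀₁+2κ₁₂| + |κ₀₁+2κ₀₂| + |κ₀₂+κ₁₂+κ₂₃|) = ∞`, where the three
displayed quantities are the diagonal components of the Ricci tensor. -/
def RicciBlowup (T : ℝ) (f g ρ : ℝ → ℝ → ℝ) : Prop :=
  ∀ K : ℝ, ∀ t₀ : ℝ, 0 ≤ t₀ → t₀ < T → ∃ ξ t : ℝ, t₀ < t ∧ t < T ∧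
    K < |k01 ρ f ξ t + 2 * k12 ρ f g ξ t| + |k01 ρ f ξ t + 2 * k02 ρ g ξ t|
        + |k02 ρ g ξ t + k12 ρ f g ξ t + k23 ρ f g ξ t|

/-- Assumption A: `f ≤ g` at `t = 0`; `(min_ξ R(ξ,0))·(max_ξ g(ξ,0)²) > −3`;
and the Ricci curvature blows up at the finite time `T`. -/
structure AssumptionA (T : ℝ) (f g ρ : ℝ → ℝ → ℝ) extends WarpedBerger T f g ρ : Prop where
  init_order : ∀ ξ : ℝ, f ξ 0 ≤ g ξ 0
  init_scalar : (⨅ ξ : ℝ, scalR ρ f g ξ 0) * (⨆ ξ : ℝ, (g ξ 0) ^ 2) > -3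
  ricci_blowup : RicciBlowup T f g ρ

/-- Assumption B: Assumption A and, in addition, at `t = 0` one has `f ≥ (1−ε)g` for some
`ε ∈ (0,1)` with `2(1−ε)⁵ + 4(1−ε)⁴ > 4/3`, and `|f_s| ≤ 1` at `t = 0`. -/
structure AssumptionB (T : ℝ) (f g ρ : ℝ → ℝ → ℝ) extends AssumptionA T f g ρ : Prop where
  init_pinched : ∃ ε : ℝ, 0 < ε ∧ ε < 1 ∧ 2 * (1 - ε) ^ 5 + 4 * (1 - ε) ^ 4 > 4 / 3 ∧
    ∀ ξ : ℝ, (1 - ε) * g ξ 0 ≤ f ξ 0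
  init_fs : ∀ ξ : ℝ, |Ds ρ f ξ 0| ≤ 1

/-- Smooth on `ℝ × (0,T)` and `2π`-periodic in space. -/
def Sm (T : ℝ) (φ : ℝ → ℝ → ℝ) : Prop :=
  (∀ ξ t : ℝ, 0 < t → t < T → ContDiffAt ℝ (⊤ : ℕ∞) (fun x : ℝ × ℝ => φ x.1 x.2) (ξ, t)) ∧
    ∀ ξ t : ℝ, φ (ξ + 2 * π) t = φ ξ t

namespace Sm
variable {T : ℝ} {φ ψ ρ : ℝ → ℝ → ℝ}

lemma const (T c : ℝ) : Sm T (fun _ _ => c) := ⟨fun _ _ _ _ => contDiffAt_const, fun _ _ => rfl⟩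

lemma add (h : Sm T φ) (k : Sm T ψ) : Sm T (fun x t => φ x t + ψ x t) :=
  ⟨fun ξ t h0 h1 => (h.1 ξ t h0 h1).add (k.1 ξ t h0 h1), fun ξ t => by simp only [h.2, k.2]⟩

lemma sub (h : Sm T φ) (k : Sm T ψ) : Sm T (fun x t => φ x t - ψ x t) :=
  ⟨fun ξ t h0 h1 => (h.1 ξ t h0 h1).sub (k.1 ξ t h0 h1), fun ξ t => by simp only [h.2, k.2]⟩

lemma mul (h : Sm T φ) (k : Sm T ψ) : Sm T (fun x t => φ x t * ψ x t) :=
  ⟨fun ξ t h0 h1 => (h.1 ξ t h0 h1).mul (k.1 ξ t h0 h1), fun ξ t => by simp only [h.2, k.2]⟩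

lemma exp (h : Sm T φ) : Sm T (fun x t => Real.exp (φ x t)) :=
  ⟨fun ξ t h0 h1 => (h.1 ξ t h0 h1).exp, fun ξ t => by simp only [h.2]⟩

lemma log (h : Sm T φ) (hp : ∀ ξ t, 0 < t → t < T → 0 < φ ξ t) :
    Sm T (fun x t => Real.log (φ x t)) :=
  ⟨fun ξ t h0 h1 => (h.1 ξ t h0 h1).log (hp ξ t h0 h1).ne', fun ξ t => by simp only [h.2]⟩

lemma ev {ξ t : ℝ} (h0 : 0 < t) (h1 : t < T) :
    ∀ᶠ x : ℝ × ℝ in 𝓝 (ξ, t), 0 < x.2 ∧ x.2 < T := by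
  have : ∀ᶠ s in 𝓝 t, 0 < s ∧ s < T := (lt_mem_nhds h0).and (gt_mem_nhds h1)
  exact (continuous_snd.tendsto (ξ, t)).eventually this

lemma hx (h : Sm T φ) {ξ t : ℝ} (h0 : 0 < t) (h1 : t < T) :
    HasDerivAt (fun x => φ x t) (fderiv ℝ (fun x : ℝ × ℝ => φ x.1 x.2) (ξ, t) (1, 0)) ξ := by
  have hd := ((h.1 ξ t h0 h1).differentiableAt (by simp)).hasFDerivAt
  have hc : HasDerivAt (fun x : ℝ => (x, t)) ((1 : ℝ), (0 : ℝ)) ξ :=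
    (hasDerivAt_id ξ).prodMk (hasDerivAt_const ξ t)
  exact hd.comp_hasDerivAt ξ hc

lemma ht (h : Sm T φ) {ξ t : ℝ} (h0 : 0 < t) (h1 : t < T) :
    HasDerivAt (fun s => φ ξ s) (fderiv ℝ (fun x : ℝ × ℝ => φ x.1 x.2) (ξ, t) (0, 1)) t := by
  have hd := ((h.1 ξ t h0 h1).differentiableAt (by simp)).hasFDerivAt
  have hc : HasDerivAt (fun s : ℝ => (ξ, s)) ((0 : ℝ), (1 : ℝ)) t :=
    (hasDerivAt_const t ξ).prodMk (hasDerivAt_id t)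
  exact hd.comp_hasDerivAt t hc

lemma pd1_eq (h : Sm T φ) {ξ t : ℝ} (h0 : 0 < t) (h1 : t < T) :
    pd1 φ ξ t = fderiv ℝ (fun x : ℝ × ℝ => φ x.1 x.2) (ξ, t) (1, 0) := (h.hx h0 h1).deriv

lemma pdt_eq (h : Sm T φ) {ξ t : ℝ} (h0 : 0 < t) (h1 : t < T) :
    pdt φ ξ t = fderiv ℝ (fun x : ℝ × ℝ => φ x.1 x.2) (ξ, t) (0, 1) := (h.ht h0 h1).deriv

lemma fd (h : Sm T φ) (v : ℝ × ℝ) {ξ t : ℝ} (h0 : 0 < t) (h1 : t < T) :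
    ContDiffAt ℝ (⊤ : ℕ∞)
      (fun z : ℝ × ℝ => fderiv ℝ (fun x : ℝ × ℝ => φ x.1 x.2) z v) (ξ, t) :=
  ((h.1 ξ t h0 h1).fderiv_right (m := (⊤ : ℕ∞)) (by simp)).clm_apply contDiffAt_const

lemma sm_pd1 (h : Sm T φ) : Sm T (pd1 φ) := by
  refine ⟨fun ξ t h0 h1 => (h.fd (1, 0) h0 h1).congr_of_eventuallyEq ?_, fun ξ t => ?_⟩
  · filter_upwards [ev h0 h1] with x hx
    exact h.pd1_eq hx.1 hx.2
  · unfold pd1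
    rw [← deriv_comp_add_const]
    simp only [h.2]

lemma sm_pdt (h : Sm T φ) : Sm T (pdt φ) := by
  refine ⟨fun ξ t h0 h1 => (h.fd (0, 1) h0 h1).congr_of_eventuallyEq ?_, fun ξ t => ?_⟩
  · filter_upwards [ev h0 h1] with x hx
    exact h.pdt_eq hx.1 hx.2
  · unfold pdt
    simp only [h.2]

lemma symm (h : Sm T φ) {ξ t : ℝ} (h0 : 0 < t) (h1 : t < T) :
    pdt (pd1 φ) ξ t = pd1 (pdt φ) ξ t := by
  have hs : IsSymmSndFDerivAt ℝ (fun x : ℝ × ℝ => φ x.1 x.2) (ξ, t) :=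
    (h.1 ξ t h0 h1).isSymmSndFDerivAt (by simp only [minSmoothness_of_isRCLikeNormedField]; exact WithTop.coe_le_coe.mpr le_top)
  have hd : DifferentiableAt ℝ (fderiv ℝ (fun x : ℝ × ℝ => φ x.1 x.2)) (ξ, t) :=
    ((h.1 ξ t h0 h1).fderiv_right (m := (⊤ : ℕ∞)) (by simp)).differentiableAt (by simp)
  rw [h.sm_pd1.pdt_eq h0 h1, h.sm_pdt.pd1_eq h0 h1]
  have e1 : (fun x : ℝ × ℝ => pd1 φ x.1 x.2) =ᶠ[𝓝 (ξ, t)]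
      fun z => fderiv ℝ (fun x : ℝ × ℝ => φ x.1 x.2) z (1, 0) := by
    filter_upwards [ev h0 h1] with x hx
    exact h.pd1_eq hx.1 hx.2
  have e2 : (fun x : ℝ × ℝ => pdt φ x.1 x.2) =ᶠ[𝓝 (ξ, t)]
      fun z => fderiv ℝ (fun x : ℝ × ℝ => φ x.1 x.2) z (0, 1) := by
    filter_upwards [ev h0 h1] with x hx
    exact h.pdt_eq hx.1 hx.2
  rw [e1.fderiv_eq, e2.fderiv_eq, fderiv_clm_apply hd (by fun_prop),
    fderiv_clm_apply hd (by fun_prop)]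
  simpa using hs (0, 1) (1, 0)

lemma sm_Ds (h : Sm T φ) (hr : Sm T ρ) (hp : ∀ ξ t, 0 < t → t < T → 0 < ρ ξ t) :
    Sm T (Ds ρ φ) :=
  ⟨fun ξ t h0 h1 => (h.sm_pd1.1 ξ t h0 h1).div (hr.1 ξ t h0 h1) (hp ξ t h0 h1).ne',
    fun ξ t => by simp only [Ds, h.sm_pd1.2, hr.2]⟩

end Sm

/-- Maximum principle. -/
lemma max_principle {T : ℝ} (hT : 0 < T) {F : ℝ → ℝ → ℝ} (hF : Sm T F) (K : ℝ)
    (h : ∀ ξ t, T / 2 < t → t < T → K < F ξ t → pd1 F ξ t = 0 → pd1 (pd1 F) ξ t ≤ 0 →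
      pdt F ξ t < 0) :
    ∃ K' : ℝ, K ≤ K' ∧ ∀ ξ t, T / 2 ≤ t → t < T → F ξ t ≤ K' := by
  have cont : ∀ ξ t, 0 < t → t < T → ContinuousAt (fun x : ℝ × ℝ => F x.1 x.2) (ξ, t) :=
    fun ξ t h0 h1 => (hF.1 ξ t h0 h1).continuousAt
  have hpi : (0 : ℝ) < 2 * π := by positivity
  have per : ∀ ξ t, ∃ y ∈ Icc 0 (2 * π), F ξ t = F y t := by
    intro ξ t
    have hp : Function.Periodic (fun x => F x t) (2 * π) := fun x => hF.2 x t
    obtain ⟨y, hy, e⟩ := hp.exists_mem_Ico₀ hpi ξ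
    exact ⟨y, ⟨hy.1, hy.2.le⟩, e⟩
  obtain ⟨K0, hK0⟩ : ∃ K0, ∀ ξ, F ξ (T / 2) ≤ K0 := by
    have : ContinuousOn (fun x => F x (T / 2)) (Icc 0 (2 * π)) := fun x _ =>
      (hF.hx (ξ := x) (by linarith) (by linarith)).continuousAt.continuousWithinAt
    obtain ⟨B, hB⟩ := (isCompact_Icc.image_of_continuousOn this).bddAbove
    refine ⟨B, fun ξ => ?_⟩
    obtain ⟨y, hy, e⟩ := per ξ (T / 2)
    rw [e]
    exact hB ⟨y, hy, rfl⟩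
  refine ⟨max K K0, le_max_left _ _, ?_⟩
  by_contra! hcon
  obtain ⟨ξ1, t1, ht1, ht1T, hlt⟩ := hcon
  have hcomp : IsCompact (Icc (0 : ℝ) (2 * π) ×ˢ Icc (T / 2) t1) := isCompact_Icc.prod isCompact_Icc
  have hco : ContinuousOn (fun x : ℝ × ℝ => F x.1 x.2) (Icc (0 : ℝ) (2 * π) ×ˢ Icc (T / 2) t1) := by
    rintro ⟨a, b⟩ ⟨_, hb⟩
    exact (cont a b (by linarith [hb.1]) (by linarith [hb.2])).continuousWithinAt
  obtain ⟨y1, hy1, e1⟩ := per ξ1 t1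
  obtain ⟨⟨a, b⟩, ⟨_, hb⟩, hmax⟩ := hcomp.exists_isMaxOn ⟨(y1, t1), hy1, ht1, le_rfl⟩ hco
  have hmax' : ∀ x s, T / 2 ≤ s → s ≤ t1 → F x s ≤ F a b := by
    intro x s hs hs1
    obtain ⟨y, hy, e⟩ := per x s
    rw [e]
    exact hmax (show (y, s) ∈ _ from ⟨hy, hs, hs1⟩)
  simp only at hb
  have hb0 : 0 < b := by linarith [hb.1]
  have hbT : b < T := by linarith [hb.2]
  have hbig : max K K0 < F a b := lt_of_lt_of_le hlt (hmax' ξ1 t1 ht1 le_rfl)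
  have hbne : T / 2 < b := by
    rcases hb.1.lt_or_eq with h | h
    · exact h
    · exfalso
      have := hK0 a
      rw [h] at this
      exact absurd (lt_of_le_of_lt (le_max_right K K0) hbig) (not_lt.mpr this)
  have hloc : IsLocalMax (fun x => F x b) a := Filter.Eventually.of_forall fun x => hmax' x b hb.1 hb.2
  have hd1 : pd1 F a b = 0 := hloc.deriv_eq_zero
  have hd2 : pd1 (pd1 F) a b ≤ 0 := by
    by_contra! hpos
    have hmin : IsLocalMin (fun x => F x b) a := by
      refine isLocalMin_of_deriv_deriv_pos ?_ hd1 (hF.hx hb0 hbT).continuousAt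
      exact hpos
    have hev : (fun x => F x b) =ᶠ[𝓝 a] fun _ => F a b := by
      filter_upwards [hmin] with x hx
      exact le_antisymm (hmax' x b hb.1 hb.2) hx
    have h2 : pd1 (pd1 F) a b = 0 := by
      have : deriv (fun x => F x b) =ᶠ[𝓝 a] deriv (fun _ => F a b) := hev.deriv
      have h3 := this.deriv_eq
      simpa [pd1] using h3
    linarith
  have hneg := h a b hbne hbT (lt_of_le_of_lt (le_max_left _ _) hbig) hd1 hd2
  have hder : HasDerivAt (fun s => F a s) (pdt F a b) b := by
    rw [hF.pdt_eq hb0 hbT]; exact hF.ht hb0 hbT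
  have hsub : Iio b ⊆ {b}ᶜ := fun x (hx : x < b) => ne_of_lt hx
  have hsl := (hasDerivAt_iff_tendsto_slope.mp hder).mono_left (nhdsWithin_mono b hsub)
  have : 0 ≤ pdt F a b := by
    refine ge_of_tendsto hsl ?_
    have hm : Ioo (T / 2) b ∈ 𝓝[<] b := Ioo_mem_nhdsLT hbne
    filter_upwards [hm] with s hs
    rw [slope_def_field]
    apply div_nonneg_of_nonpos
    · linarith [hmax' a s hs.1.le (by linarith [hs.2, hb.2])]
    · linarith [hs.2]
  linarith

/-- The heat operator `∂_t - Δ` in terms of `u = log f`, `w = log (f/g)`. -/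
def Hop (ρ u w φ : ℝ → ℝ → ℝ) (ξ t : ℝ) : ℝ :=
  pdt φ ξ t - Ds ρ (Ds ρ φ) ξ t - (3 * Ds ρ u ξ t - 2 * Ds ρ w ξ t) * Ds ρ φ ξ t

/-- The flow written in terms of `u = log f`, `w = log (f/g)`. -/
structure Sys (T : ℝ) (ρ u w : ℝ → ℝ → ℝ) : Prop where
  hT : 0 < T
  sρ : Sm T ρ
  pos : ∀ ξ t, 0 < t → t < T → 0 < ρ ξ t
  su : Sm T u
  sw : Sm T w
  eu : ∀ ξ t, 0 < t → t < T → Hop ρ u w u ξ t = -2 * exp (4 * w ξ t - 2 * u ξ t)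
  ew : ∀ ξ t, 0 < t → t < T → Hop ρ u w w ξ t =
    4 * exp (2 * w ξ t - 2 * u ξ t) - 4 * exp (4 * w ξ t - 2 * u ξ t)
  eρ : ∀ ξ t, 0 < t → t < T → pdt ρ ξ t = ρ ξ t * (
    3 * Ds ρ (Ds ρ u) ξ t - 2 * Ds ρ (Ds ρ w) ξ t
      + (Ds ρ u ξ t) ^ 2 + 2 * (Ds ρ u ξ t - Ds ρ w ξ t) ^ 2)

namespace Sys
variable {T : ℝ} {ρ u w φ ψ : ℝ → ℝ → ℝ}

lemma sD (S : Sys T ρ u w) (h : Sm T φ) : Sm T (Ds ρ φ) := h.sm_Ds S.sρ S.pos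

lemma dx (S : Sys T ρ u w) (h : Sm T φ) {ξ t : ℝ} (h0 : 0 < t) (h1 : t < T) :
    HasDerivAt (fun x => φ x t) (ρ ξ t * Ds ρ φ ξ t) ξ := by
  have := S.pos ξ t h0 h1
  rw [Ds, mul_div_cancel₀ _ this.ne', h.pd1_eq h0 h1]
  exact h.hx h0 h1

lemma dt (_S : Sys T ρ u w) (h : Sm T φ) {ξ t : ℝ} (h0 : 0 < t) (h1 : t < T) :
    HasDerivAt (fun s => φ ξ s) (pdt φ ξ t) t := by
  rw [h.pdt_eq h0 h1]
  exact h.ht h0 h1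

lemma of_dx (S : Sys T ρ u w) {ξ t d : ℝ} (h0 : 0 < t) (h1 : t < T)
    (h : HasDerivAt (fun x => φ x t) (ρ ξ t * d) ξ) : Ds ρ φ ξ t = d := by
  have := S.pos ξ t h0 h1
  rw [Ds, pd1, h.deriv]
  field_simp

lemma D_congr {ξ t : ℝ} (h : ∀ x, φ x t = ψ x t) : Ds ρ φ ξ t = Ds ρ ψ ξ t := by
  simp only [Ds, pd1, h]

lemma D_add (S : Sys T ρ u w) (h : Sm T φ) (k : Sm T ψ) {ξ t : ℝ} (h0 : 0 < t) (h1 : t < T) :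
    Ds ρ (fun x t => φ x t + ψ x t) ξ t = Ds ρ φ ξ t + Ds ρ ψ ξ t := by
  refine S.of_dx h0 h1 (((S.dx h h0 h1).add (S.dx k h0 h1)).congr_deriv ?_)
  ring

lemma D_mul (S : Sys T ρ u w) (h : Sm T φ) (k : Sm T ψ) {ξ t : ℝ} (h0 : 0 < t) (h1 : t < T) :
    Ds ρ (fun x t => φ x t * ψ x t) ξ t = φ ξ t * Ds ρ ψ ξ t + ψ ξ t * Ds ρ φ ξ t := by
  refine S.of_dx h0 h1 (((S.dx h h0 h1).mul (S.dx k h0 h1)).congr_deriv ?_)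
  ring

lemma D_exp (S : Sys T ρ u w) (h : Sm T φ) {ξ t : ℝ} (h0 : 0 < t) (h1 : t < T) :
    Ds ρ (fun x t => exp (φ x t)) ξ t = exp (φ ξ t) * Ds ρ φ ξ t := by
  refine S.of_dx h0 h1 (((S.dx h h0 h1).exp).congr_deriv ?_)
  ring

lemma D_const (S : Sys T ρ u w) (c : ℝ) {ξ t : ℝ} :
    Ds ρ (fun _ _ => c) ξ t = 0 := by
  simp [Ds, pd1]

lemma pdt_D (S : Sys T ρ u w) (h : Sm T φ) {ξ t : ℝ} (h0 : 0 < t) (h1 : t < T) :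
    pdt (Ds ρ φ) ξ t = Ds ρ (pdt φ) ξ t - (3 * Ds ρ (Ds ρ u) ξ t - 2 * Ds ρ (Ds ρ w) ξ t
      + (Ds ρ u ξ t) ^ 2 + 2 * (Ds ρ u ξ t - Ds ρ w ξ t) ^ 2) * Ds ρ φ ξ t := by
  have hp := S.pos ξ t h0 h1
  have h2 := ((S.dt h.sm_pd1 (ξ := ξ) h0 h1).div (S.dt S.sρ (ξ := ξ) h0 h1) hp.ne').deriv
  have h3 : pdt (Ds ρ φ) ξ t = (pdt (pd1 φ) ξ t * ρ ξ t - pd1 φ ξ t * pdt ρ ξ t) / ρ ξ t ^ 2 := h2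
  rw [h3, h.symm h0 h1, S.eρ ξ t h0 h1]
  simp only [Ds]
  field_simp

lemma H_mul (S : Sys T ρ u w) (h : Sm T φ) (k : Sm T ψ) {ξ t : ℝ} (h0 : 0 < t) (h1 : t < T) :
    Hop ρ u w (fun x t => φ x t * ψ x t) ξ t = φ ξ t * Hop ρ u w ψ ξ t + ψ ξ t * Hop ρ u w φ ξ t
      - 2 * Ds ρ φ ξ t * Ds ρ ψ ξ t := by
  have e1 : pdt (fun x t => φ x t * ψ x t) ξ t = _ :=
    ((S.dt h (ξ := ξ) h0 h1).mul (S.dt k (ξ := ξ) h0 h1)).deriv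
  have e2 : Ds ρ (Ds ρ (fun x t => φ x t * ψ x t)) ξ t
      = Ds ρ (fun x t => φ x t * Ds ρ ψ x t + ψ x t * Ds ρ φ x t) ξ t :=
    D_congr fun x => S.D_mul h k h0 h1
  rw [Hop, e1, e2, S.D_add (h.mul (S.sD k)) (k.mul (S.sD h)) h0 h1, S.D_mul h (S.sD k) h0 h1,
    S.D_mul k (S.sD h) h0 h1, S.D_mul h k h0 h1, Hop, Hop]
  ring

lemma H_add (S : Sys T ρ u w) (h : Sm T φ) (k : Sm T ψ) {ξ t : ℝ} (h0 : 0 < t) (h1 : t < T) :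
    Hop ρ u w (fun x t => φ x t + ψ x t) ξ t = Hop ρ u w φ ξ t + Hop ρ u w ψ ξ t := by
  have e1 : pdt (fun x t => φ x t + ψ x t) ξ t = _ :=
    ((S.dt h (ξ := ξ) h0 h1).add (S.dt k (ξ := ξ) h0 h1)).deriv
  have e2 : Ds ρ (Ds ρ (fun x t => φ x t + ψ x t)) ξ t
      = Ds ρ (fun x t => Ds ρ φ x t + Ds ρ ψ x t) ξ t :=
    D_congr fun x => S.D_add h k h0 h1
  rw [Hop, e1, e2, S.D_add (S.sD h) (S.sD k) h0 h1, S.D_add h k h0 h1, Hop, Hop]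
  ring

lemma H_exp (S : Sys T ρ u w) (h : Sm T φ) {ξ t : ℝ} (h0 : 0 < t) (h1 : t < T) :
    Hop ρ u w (fun x t => exp (φ x t)) ξ t
      = exp (φ ξ t) * (Hop ρ u w φ ξ t - (Ds ρ φ ξ t) ^ 2) := by
  have e1 : pdt (fun x t => exp (φ x t)) ξ t = _ := ((S.dt h (ξ := ξ) h0 h1).exp).deriv
  have e2 : Ds ρ (Ds ρ (fun x t => exp (φ x t))) ξ t
      = Ds ρ (fun x t => exp (φ x t) * Ds ρ φ x t) ξ t :=
    D_congr fun x => S.D_exp h h0 h1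
  rw [Hop, e1, e2, S.D_mul h.exp (S.sD h) h0 h1, S.D_exp h h0 h1, Hop]
  ring

lemma H_const (S : Sys T ρ u w) (c : ℝ) {ξ t : ℝ} :
    Hop ρ u w (fun _ _ => c) ξ t = 0 := by
  have : Ds ρ (Ds ρ (fun _ _ => c)) ξ t = Ds ρ (fun _ _ => 0) ξ t := D_congr fun x => S.D_const c
  rw [Hop, this, S.D_const, S.D_const]
  simp [pdt]

lemma H_cmul (S : Sys T ρ u w) (h : Sm T φ) (c : ℝ) {ξ t : ℝ} (h0 : 0 < t) (h1 : t < T) :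
    Hop ρ u w (fun x t => c * φ x t) ξ t = c * Hop ρ u w φ ξ t := by
  rw [S.H_mul (Sm.const T c) h h0 h1, S.H_const, S.D_const]
  ring

lemma D_cmul (S : Sys T ρ u w) (h : Sm T φ) (c : ℝ) {ξ t : ℝ} (h0 : 0 < t) (h1 : t < T) :
    Ds ρ (fun x t => c * φ x t) ξ t = c * Ds ρ φ ξ t := by
  rw [S.D_mul (Sm.const T c) h h0 h1, S.D_const]
  ring

lemma sH (S : Sys T ρ u w) (h : Sm T φ) : Sm T (Hop ρ u w φ) :=
  (h.sm_pdt.sub (S.sD (S.sD h))).sub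
    ((((Sm.const T 3).mul (S.sD S.su)).sub ((Sm.const T 2).mul (S.sD S.sw))).mul (S.sD h))

/-- The commutator rule. -/
lemma H_D (S : Sys T ρ u w) (h : Sm T φ) {ξ t : ℝ} (h0 : 0 < t) (h1 : t < T) :
    Hop ρ u w (Ds ρ φ) ξ t = Ds ρ (Hop ρ u w φ) ξ t
      - ((Ds ρ u ξ t) ^ 2 + 2 * (Ds ρ u ξ t - Ds ρ w ξ t) ^ 2) * Ds ρ φ ξ t := by
  have e : Ds ρ (Hop ρ u w φ) ξ t = Ds ρ (pdt φ) ξ t - Ds ρ (Ds ρ (Ds ρ φ)) ξ t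
      - ((3 * Ds ρ (Ds ρ u) ξ t - 2 * Ds ρ (Ds ρ w) ξ t) * Ds ρ φ ξ t
        + (3 * Ds ρ u ξ t - 2 * Ds ρ w ξ t) * Ds ρ (Ds ρ φ) ξ t) := by
    refine S.of_dx h0 h1 ((((S.dx h.sm_pdt h0 h1).sub (S.dx (S.sD (S.sD h)) h0 h1)).sub
      ((((S.dx (S.sD S.su) h0 h1).const_mul 3).sub ((S.dx (S.sD S.sw) h0 h1).const_mul 2)).mul
        (S.dx (S.sD h) h0 h1))).congr_deriv ?_)
    simp only [Pi.sub_apply]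
    ring
  rw [Hop, S.pdt_D h h0 h1, e]
  ring

/-- Maximum principle for the heat operator. -/
lemma mp (S : Sys T ρ u w) (h : Sm T φ) (K : ℝ)
    (H : ∀ ξ t, T / 2 < t → t < T → K < φ ξ t → Ds ρ φ ξ t = 0 → Hop ρ u w φ ξ t < 0) :
    ∃ K' : ℝ, K ≤ K' ∧ ∀ ξ t, T / 2 ≤ t → t < T → φ ξ t ≤ K' := by
  refine max_principle S.hT h K fun ξ t h2 h1 hK hd hdd => ?_
  have h0 : 0 < t := by linarith [S.hT]
  have hp := S.pos ξ t h0 h1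
  have hD : Ds ρ φ ξ t = 0 := by rw [Ds, hd, zero_div]
  have hDD : Ds ρ (Ds ρ φ) ξ t ≤ 0 := by
    have e := ((S.dx h.sm_pd1 (ξ := ξ) h0 h1).div (S.dx S.sρ (ξ := ξ) h0 h1) hp.ne').deriv
    have e' : pd1 (Ds ρ φ) ξ t = _ := e
    have e2 : ρ ξ t * Ds ρ (pd1 φ) ξ t = pd1 (pd1 φ) ξ t := by
      rw [Ds]; field_simp
    rw [Ds, e', e2, hd]
    apply div_nonpos_of_nonpos_of_nonneg _ hp.le
    apply div_nonpos_of_nonpos_of_nonneg _ (by positivity)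
    nlinarith
  have := H ξ t h2 h1 hK hD
  rw [Hop, hD] at this
  linarith

/-- Weighted energy inequality. -/
lemma weight (S : Sys T ρ u w) (h : Sm T φ) (m : ℝ) {ξ t : ℝ} (h0 : 0 < t) (h1 : t < T) :
    exp (2 * u ξ t) * Hop ρ u w (fun x t => exp (m * u x t) * (φ x t * φ x t)) ξ t ≤
      exp (m * u ξ t) * (2 * φ ξ t * (exp (2 * u ξ t) * Hop ρ u w φ ξ t)
        - exp (2 * u ξ t) * (Ds ρ φ ξ t) ^ 2
        + (3 * m ^ 2 * (exp (u ξ t) * Ds ρ u ξ t) ^ 2 + 2 * |m| * exp (4 * w ξ t)) * φ ξ t ^ 2) := by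
  have sm := (Sm.const T m).mul S.su
  rw [S.H_mul sm.exp (h.mul h) h0 h1, S.H_mul h h h0 h1, S.H_exp sm h0 h1, S.D_exp sm h0 h1,
    S.D_mul h h h0 h1, S.H_cmul S.su m h0 h1, S.D_cmul S.su m h0 h1, S.eu ξ t h0 h1]
  have hE : exp (2 * u ξ t) = exp (u ξ t) ^ 2 := by rw [← Real.exp_nat_mul]; norm_num
  have hA : exp (4 * w ξ t - 2 * u ξ t) * exp (u ξ t) ^ 2 = exp (4 * w ξ t) := by
    rw [← hE, ← exp_add]; ring_nf
  rw [hE]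
  generalize exp (4 * w ξ t - 2 * u ξ t) = z at *
  have hz : 0 ≤ exp (4 * w ξ t) := (exp_pos _).le
  rw [← hA] at hz ⊢
  have hθ := (exp_pos (m * u ξ t)).le
  generalize exp (m * u ξ t) = θ at *
  generalize exp (u ξ t) = E at *
  generalize φ ξ t = F
  generalize Ds ρ φ ξ t = dF
  generalize Ds ρ u ξ t = du
  generalize Hop ρ u w φ ξ t = HF
  have key : -2 * m * (z * E ^ 2) ≤ 2 * |m| * (z * E ^ 2) := by
    nlinarith [neg_abs_le m]
  have key2 : 0 ≤ θ * E ^ 2 * (dF + 2 * m * du * F) ^ 2 := by positivity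
  have key3 : 0 ≤ θ * F ^ 2 * (2 * |m| * (z * E ^ 2) - (-2 * m * (z * E ^ 2))) :=
    mul_nonneg (by positivity) (by linarith)
  nlinarith [key2, key3]

end Sys

namespace Sys
variable {T : ℝ} {ρ u w φ ψ : ℝ → ℝ → ℝ}

lemma HDu (S : Sys T ρ u w) {ξ t : ℝ} (h0 : 0 < t) (h1 : t < T) :
    Hop ρ u w (Ds ρ u) ξ t =
      -2 * (exp (4 * w ξ t - 2 * u ξ t) * (4 * Ds ρ w ξ t - 2 * Ds ρ u ξ t))
      - (Ds ρ u ξ t * Ds ρ u ξ t + 2 * ((Ds ρ u ξ t - Ds ρ w ξ t) * (Ds ρ u ξ t - Ds ρ w ξ t)))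
        * Ds ρ u ξ t := by
  have e : Ds ρ (Hop ρ u w u) ξ t = Ds ρ (fun x t => -2 * exp (4 * w x t - 2 * u x t)) ξ t :=
    D_congr fun x => S.eu x t h0 h1
  have e2 : Ds ρ (fun x t => -2 * exp (4 * w x t - 2 * u x t)) ξ t =
      -2 * (exp (4 * w ξ t - 2 * u ξ t) * (4 * Ds ρ w ξ t - 2 * Ds ρ u ξ t)) := by
    refine S.of_dx h0 h1 (((((S.dx S.sw h0 h1).const_mul 4).sub
      ((S.dx S.su h0 h1).const_mul 2)).exp.const_mul (-2)).congr_deriv ?_)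
    simp only [Pi.sub_apply]
    ring
  rw [S.H_D S.su h0 h1, e, e2]
  ring

lemma HDw (S : Sys T ρ u w) {ξ t : ℝ} (h0 : 0 < t) (h1 : t < T) :
    Hop ρ u w (Ds ρ w) ξ t =
      4 * (exp (2 * w ξ t - 2 * u ξ t) * (2 * Ds ρ w ξ t - 2 * Ds ρ u ξ t))
      - 4 * (exp (4 * w ξ t - 2 * u ξ t) * (4 * Ds ρ w ξ t - 2 * Ds ρ u ξ t))
      - (Ds ρ u ξ t * Ds ρ u ξ t + 2 * ((Ds ρ u ξ t - Ds ρ w ξ t) * (Ds ρ u ξ t - Ds ρ w ξ t)))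
        * Ds ρ w ξ t := by
  have e : Ds ρ (Hop ρ u w w) ξ t = Ds ρ (fun x t => 4 * exp (2 * w x t - 2 * u x t)
      - 4 * exp (4 * w x t - 2 * u x t)) ξ t :=
    D_congr fun x => S.ew x t h0 h1
  have e2 : Ds ρ (fun x t => 4 * exp (2 * w x t - 2 * u x t)
      - 4 * exp (4 * w x t - 2 * u x t)) ξ t =
      4 * (exp (2 * w ξ t - 2 * u ξ t) * (2 * Ds ρ w ξ t - 2 * Ds ρ u ξ t))
      - 4 * (exp (4 * w ξ t - 2 * u ξ t) * (4 * Ds ρ w ξ t - 2 * Ds ρ u ξ t)) := by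
    refine S.of_dx h0 h1 (((((S.dx S.sw h0 h1).const_mul 2).sub
      ((S.dx S.su h0 h1).const_mul 2)).exp.const_mul 4).sub ((((S.dx S.sw h0 h1).const_mul 4).sub
      ((S.dx S.su h0 h1).const_mul 2)).exp.const_mul 4) |>.congr_deriv ?_)
    simp only [Pi.sub_apply]
    ring
  rw [S.H_D S.sw h0 h1, e, e2]
  ring

lemma HDDu (S : Sys T ρ u w) {ξ t : ℝ} (h0 : 0 < t) (h1 : t < T) :
    Hop ρ u w (Ds ρ (Ds ρ u)) ξ t =
      -2 * (exp (4 * w ξ t - 2 * u ξ t) * ((4 * Ds ρ w ξ t - 2 * Ds ρ u ξ t) ^ 2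
        + (4 * Ds ρ (Ds ρ w) ξ t - 2 * Ds ρ (Ds ρ u) ξ t)))
      - 2 * (Ds ρ u ξ t ^ 2 + 2 * (Ds ρ u ξ t - Ds ρ w ξ t) ^ 2) * Ds ρ (Ds ρ u) ξ t
      - (2 * Ds ρ u ξ t * Ds ρ (Ds ρ u) ξ t + 4 * (Ds ρ u ξ t - Ds ρ w ξ t) *
        (Ds ρ (Ds ρ u) ξ t - Ds ρ (Ds ρ w) ξ t)) * Ds ρ u ξ t := by
  have du := S.dx (S.sD S.su) (ξ := ξ) h0 h1
  have dw := S.dx (S.sD S.sw) (ξ := ξ) h0 h1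
  have e2 := S.of_dx (φ := fun ξ t =>
      -2 * (exp (4 * w ξ t - 2 * u ξ t) * (4 * Ds ρ w ξ t - 2 * Ds ρ u ξ t))
      - (Ds ρ u ξ t * Ds ρ u ξ t + 2 * ((Ds ρ u ξ t - Ds ρ w ξ t) * (Ds ρ u ξ t - Ds ρ w ξ t)))
        * Ds ρ u ξ t) (ξ := ξ) h0 h1 (d :=
      -2 * (exp (4 * w ξ t - 2 * u ξ t) * ((4 * Ds ρ w ξ t - 2 * Ds ρ u ξ t) ^ 2
        + (4 * Ds ρ (Ds ρ w) ξ t - 2 * Ds ρ (Ds ρ u) ξ t)))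
      - (Ds ρ u ξ t ^ 2 + 2 * (Ds ρ u ξ t - Ds ρ w ξ t) ^ 2) * Ds ρ (Ds ρ u) ξ t
      - (2 * Ds ρ u ξ t * Ds ρ (Ds ρ u) ξ t + 4 * (Ds ρ u ξ t - Ds ρ w ξ t) *
        (Ds ρ (Ds ρ u) ξ t - Ds ρ (Ds ρ w) ξ t)) * Ds ρ u ξ t) (by
    refine HasDerivAt.congr_deriv ((((((S.dx S.sw h0 h1).const_mul 4).sub
      ((S.dx S.su h0 h1).const_mul 2)).exp.mul ((dw.const_mul 4).sub
      (du.const_mul 2))).const_mul (-2)).sub (((du.mul du).add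
        (((du.sub dw).mul (du.sub dw)).const_mul 2)).mul du)) ?_
    simp only [Pi.sub_apply, Pi.mul_apply, Pi.add_apply]
    ring)
  have e := (D_congr (φ := Hop ρ u w (Ds ρ u)) (ρ := ρ) (ξ := ξ) (t := t)
    (fun x => by exact S.HDu h0 h1)).trans e2
  rw [S.H_D (S.sD S.su) h0 h1, e]
  ring

lemma HDDw (S : Sys T ρ u w) {ξ t : ℝ} (h0 : 0 < t) (h1 : t < T) :
    Hop ρ u w (Ds ρ (Ds ρ w)) ξ t =
      4 * (exp (2 * w ξ t - 2 * u ξ t) * ((2 * Ds ρ w ξ t - 2 * Ds ρ u ξ t) ^ 2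
        + (2 * Ds ρ (Ds ρ w) ξ t - 2 * Ds ρ (Ds ρ u) ξ t)))
      - 4 * (exp (4 * w ξ t - 2 * u ξ t) * ((4 * Ds ρ w ξ t - 2 * Ds ρ u ξ t) ^ 2
        + (4 * Ds ρ (Ds ρ w) ξ t - 2 * Ds ρ (Ds ρ u) ξ t)))
      - 2 * (Ds ρ u ξ t ^ 2 + 2 * (Ds ρ u ξ t - Ds ρ w ξ t) ^ 2) * Ds ρ (Ds ρ w) ξ t
      - (2 * Ds ρ u ξ t * Ds ρ (Ds ρ u) ξ t + 4 * (Ds ρ u ξ t - Ds ρ w ξ t) *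
        (Ds ρ (Ds ρ u) ξ t - Ds ρ (Ds ρ w) ξ t)) * Ds ρ w ξ t := by
  have du := S.dx (S.sD S.su) (ξ := ξ) h0 h1
  have dw := S.dx (S.sD S.sw) (ξ := ξ) h0 h1
  have e2 := S.of_dx (φ := fun ξ t =>
      4 * (exp (2 * w ξ t - 2 * u ξ t) * (2 * Ds ρ w ξ t - 2 * Ds ρ u ξ t))
      - 4 * (exp (4 * w ξ t - 2 * u ξ t) * (4 * Ds ρ w ξ t - 2 * Ds ρ u ξ t))
      - (Ds ρ u ξ t * Ds ρ u ξ t + 2 * ((Ds ρ u ξ t - Ds ρ w ξ t) * (Ds ρ u ξ t - Ds ρ w ξ t)))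
        * Ds ρ w ξ t) (ξ := ξ) h0 h1 (d :=
      4 * (exp (2 * w ξ t - 2 * u ξ t) * ((2 * Ds ρ w ξ t - 2 * Ds ρ u ξ t) ^ 2
        + (2 * Ds ρ (Ds ρ w) ξ t - 2 * Ds ρ (Ds ρ u) ξ t)))
      - 4 * (exp (4 * w ξ t - 2 * u ξ t) * ((4 * Ds ρ w ξ t - 2 * Ds ρ u ξ t) ^ 2
        + (4 * Ds ρ (Ds ρ w) ξ t - 2 * Ds ρ (Ds ρ u) ξ t)))
      - (Ds ρ u ξ t ^ 2 + 2 * (Ds ρ u ξ t - Ds ρ w ξ t) ^ 2) * Ds ρ (Ds ρ w) ξ t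
      - (2 * Ds ρ u ξ t * Ds ρ (Ds ρ u) ξ t + 4 * (Ds ρ u ξ t - Ds ρ w ξ t) *
        (Ds ρ (Ds ρ u) ξ t - Ds ρ (Ds ρ w) ξ t)) * Ds ρ w ξ t) (by
    refine HasDerivAt.congr_deriv (((((((S.dx S.sw h0 h1).const_mul 2).sub
      ((S.dx S.su h0 h1).const_mul 2)).exp.mul ((dw.const_mul 2).sub
      (du.const_mul 2))).const_mul 4).sub ((((((S.dx S.sw h0 h1).const_mul 4).sub
      ((S.dx S.su h0 h1).const_mul 2)).exp.mul ((dw.const_mul 4).sub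
      (du.const_mul 2))).const_mul 4))).sub (((du.mul du).add
        (((du.sub dw).mul (du.sub dw)).const_mul 2)).mul dw)) ?_
    simp only [Pi.sub_apply, Pi.mul_apply, Pi.add_apply]
    ring)
  have e := (D_congr (φ := Hop ρ u w (Ds ρ w)) (ρ := ρ) (ξ := ξ) (t := t)
    (fun x => by exact S.HDw h0 h1)).trans e2
  rw [S.H_D (S.sD S.sw) h0 h1, e]
  ring

end Sys

/-- scale invariant first derivative -/
def q1 (ρ u φ : ℝ → ℝ → ℝ) (ξ t : ℝ) : ℝ := exp (u ξ t) * Ds ρ φ ξ t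
/-- scale invariant second derivative -/
def q2 (ρ u φ : ℝ → ℝ → ℝ) (ξ t : ℝ) : ℝ := exp (u ξ t) ^ 2 * Ds ρ (Ds ρ φ) ξ t

lemma ee1 (a b : ℝ) : exp b ^ 2 * exp (4 * a - 2 * b) = exp (4 * a) := by
  rw [← Real.exp_nat_mul, ← exp_add]; ring_nf
lemma ee2 (a b : ℝ) : exp b ^ 2 * exp (2 * a - 2 * b) = exp (2 * a) := by
  rw [← Real.exp_nat_mul, ← exp_add]; ring_nf

namespace Sys
variable {T : ℝ} {ρ u w φ ψ : ℝ → ℝ → ℝ}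

lemma N0u (S : Sys T ρ u w) {ξ t : ℝ} (h0 : 0 < t) (h1 : t < T) :
    exp (u ξ t) ^ 2 * Hop ρ u w u ξ t = -2 * exp (4 * w ξ t) := by
  rw [S.eu ξ t h0 h1, ← ee1 (w ξ t) (u ξ t)]; ring

lemma N0w (S : Sys T ρ u w) {ξ t : ℝ} (h0 : 0 < t) (h1 : t < T) :
    exp (u ξ t) ^ 2 * Hop ρ u w w ξ t = 4 * exp (2 * w ξ t) - 4 * exp (4 * w ξ t) := by
  rw [S.ew ξ t h0 h1, ← ee1 (w ξ t) (u ξ t), ← ee2 (w ξ t) (u ξ t)]; ring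

lemma N1u (S : Sys T ρ u w) {ξ t : ℝ} (h0 : 0 < t) (h1 : t < T) :
    exp (u ξ t) ^ 3 * Hop ρ u w (Ds ρ u) ξ t =
      -2 * exp (4 * w ξ t) * (4 * q1 ρ u w ξ t - 2 * q1 ρ u u ξ t)
      - (q1 ρ u u ξ t ^ 2 + 2 * (q1 ρ u u ξ t - q1 ρ u w ξ t) ^ 2) * q1 ρ u u ξ t := by
  rw [S.HDu h0 h1, ← ee1 (w ξ t) (u ξ t)]; simp only [q1]; ring

lemma N1w (S : Sys T ρ u w) {ξ t : ℝ} (h0 : 0 < t) (h1 : t < T) :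
    exp (u ξ t) ^ 3 * Hop ρ u w (Ds ρ w) ξ t =
      4 * exp (2 * w ξ t) * (2 * q1 ρ u w ξ t - 2 * q1 ρ u u ξ t)
      - 4 * exp (4 * w ξ t) * (4 * q1 ρ u w ξ t - 2 * q1 ρ u u ξ t)
      - (q1 ρ u u ξ t ^ 2 + 2 * (q1 ρ u u ξ t - q1 ρ u w ξ t) ^ 2) * q1 ρ u w ξ t := by
  rw [S.HDw h0 h1, ← ee1 (w ξ t) (u ξ t), ← ee2 (w ξ t) (u ξ t)]; simp only [q1]; ring

lemma N2u (S : Sys T ρ u w) {ξ t : ℝ} (h0 : 0 < t) (h1 : t < T) :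
    exp (u ξ t) ^ 4 * Hop ρ u w (Ds ρ (Ds ρ u)) ξ t =
      -2 * exp (4 * w ξ t) * ((4 * q1 ρ u w ξ t - 2 * q1 ρ u u ξ t) ^ 2
        + (4 * q2 ρ u w ξ t - 2 * q2 ρ u u ξ t))
      - 2 * (q1 ρ u u ξ t ^ 2 + 2 * (q1 ρ u u ξ t - q1 ρ u w ξ t) ^ 2) * q2 ρ u u ξ t
      - (2 * q1 ρ u u ξ t * q2 ρ u u ξ t + 4 * (q1 ρ u u ξ t - q1 ρ u w ξ t) *
        (q2 ρ u u ξ t - q2 ρ u w ξ t)) * q1 ρ u u ξ t := by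
  rw [S.HDDu h0 h1, ← ee1 (w ξ t) (u ξ t)]; simp only [q1, q2]; ring

lemma N2w (S : Sys T ρ u w) {ξ t : ℝ} (h0 : 0 < t) (h1 : t < T) :
    exp (u ξ t) ^ 4 * Hop ρ u w (Ds ρ (Ds ρ w)) ξ t =
      4 * exp (2 * w ξ t) * ((2 * q1 ρ u w ξ t - 2 * q1 ρ u u ξ t) ^ 2
        + (2 * q2 ρ u w ξ t - 2 * q2 ρ u u ξ t))
      - 4 * exp (4 * w ξ t) * ((4 * q1 ρ u w ξ t - 2 * q1 ρ u u ξ t) ^ 2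
        + (4 * q2 ρ u w ξ t - 2 * q2 ρ u u ξ t))
      - 2 * (q1 ρ u u ξ t ^ 2 + 2 * (q1 ρ u u ξ t - q1 ρ u w ξ t) ^ 2) * q2 ρ u w ξ t
      - (2 * q1 ρ u u ξ t * q2 ρ u u ξ t + 4 * (q1 ρ u u ξ t - q1 ρ u w ξ t) *
        (q2 ρ u u ξ t - q2 ρ u w ξ t)) * q1 ρ u w ξ t := by
  rw [S.HDDw h0 h1, ← ee1 (w ξ t) (u ξ t), ← ee2 (w ξ t) (u ξ t)]; simp only [q1, q2]; ring

end Sys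

namespace Sys
variable {T : ℝ} {ρ u w φ ψ : ℝ → ℝ → ℝ}

lemma neg_of_E {E x : ℝ} (h : exp E ^ 2 * x < 0) : x < 0 := by
  by_contra! hx
  have : 0 ≤ exp E ^ 2 * x := by positivity
  linarith

lemma S0 (S : Sys T ρ u w) : ∃ K, ∀ ξ t, T / 2 ≤ t → t < T → u ξ t ≤ K := by
  obtain ⟨K, _, h⟩ := S.mp S.su 0 (fun ξ t h2 h1 _ _ => by
    rw [S.eu ξ t (by linarith [S.hT]) h1]
    linarith [exp_pos (4 * w ξ t - 2 * u ξ t)])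
  exact ⟨K, h⟩

lemma wineq (x : ℝ) : x * (1 - exp (2 * x)) ≤ -2 * exp (-2 * |x|) * x ^ 2 := by
  rcases le_total 0 x with h | h
  · have h1 := Real.add_one_le_exp (2 * x)
    have h2 : exp (-2 * |x|) ≤ 1 := by
      rw [Real.exp_le_one_iff]; nlinarith [abs_nonneg x]
    have : x * (1 - exp (2 * x)) ≤ x * (-2 * x) := mul_le_mul_of_nonneg_left (by linarith) h
    nlinarith [mul_nonneg (sub_nonneg.2 h2) (sq_nonneg x)]
  · have h1 := Real.add_one_le_exp (-2 * x)
    have e : -2 * |x| = 2 * x := by rw [abs_of_nonpos h]; ring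
    rw [e]
    have h3 : exp (2 * x) * exp (-2 * x) = 1 := by rw [← exp_add]; simp
    have h4 := exp_pos (2 * x)
    have h5 : exp (2 * x) * (-2 * x) ≤ 1 - exp (2 * x) := by nlinarith
    nlinarith

lemma S1 (S : Sys T ρ u w) : ∃ K, ∀ ξ t, T / 2 ≤ t → t < T → |w ξ t| ≤ K := by
  obtain ⟨K, hK, h⟩ := S.mp (S.sw.mul S.sw) 0 (fun ξ t h2 h1 hp _ => by
    have h0 : 0 < t := by linarith [S.hT]
    rw [S.H_mul S.sw S.sw h0 h1]
    apply neg_of_E (E := u ξ t)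
    have e := S.N0w (ξ := ξ) h0 h1
    have e4 : exp (4 * w ξ t) = exp (2 * w ξ t) * exp (2 * w ξ t) := by rw [← exp_add]; ring_nf
    have h3 := wineq (w ξ t)
    have h4 : 0 < exp (-2 * |w ξ t|) * (w ξ t) ^ 2 := by
      have : 0 < (w ξ t) ^ 2 := by nlinarith
      positivity
    have h5 := exp_pos (2 * w ξ t)
    have h6 : 0 ≤ (exp (u ξ t) * Ds ρ w ξ t) ^ 2 := sq_nonneg _
    have h7 : w ξ t * (1 - exp (2 * w ξ t)) < 0 := by linarith
    have h8 := mul_neg_of_pos_of_neg h5 h7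
    calc _ = 2 * w ξ t * (exp (u ξ t) ^ 2 * Hop ρ u w w ξ t)
          - 2 * (exp (u ξ t) * Ds ρ w ξ t) ^ 2 := by ring
      _ < 0 := by rw [e, e4]; nlinarith)
  refine ⟨K + 1, fun ξ t h2 h1 => ?_⟩
  have := h ξ t h2 h1
  apply abs_le_of_sq_le_sq _ (by linarith)
  nlinarith

lemma S2 (S : Sys T ρ u w) : ∃ K, 0 ≤ K ∧ ∀ ξ t, T / 2 ≤ t → t < T → |q1 ρ u u ξ t| ≤ K := by
  obtain ⟨W, hW⟩ := S.S1
  have sP : Sm T (q1 ρ u u) := S.su.exp.mul (S.sD S.su)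
  obtain ⟨K, hK, h⟩ := S.mp (sP.mul sP) (4 / 3 * exp (4 * W)) (fun ξ t h2 h1 hp hd => by
    have h0 : 0 < t := by linarith [S.hT]
    have hA : exp (4 * w ξ t) ≤ exp (4 * W) := by
      rw [exp_le_exp]; linarith [le_abs_self (w ξ t), hW ξ t h2.le h1]
    rw [S.D_mul sP sP h0 h1] at hd
    rw [S.H_mul sP sP h0 h1]
    have hP0 : q1 ρ u u ξ t ≠ 0 := by
      intro h; rw [h] at hp; linarith [exp_pos (4 * W)]
    have hD : Ds ρ (q1 ρ u u) ξ t = 0 := by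
      have : q1 ρ u u ξ t * Ds ρ (q1 ρ u u) ξ t = 0 := by linarith
      exact (mul_eq_zero.1 this).resolve_left hP0
    have eD : Ds ρ (q1 ρ u u) ξ t = _ := S.D_mul S.su.exp (S.sD S.su) h0 h1
    rw [S.D_exp S.su h0 h1, hD] at eD
    have eH : Hop ρ u w (q1 ρ u u) ξ t = _ := S.H_mul S.su.exp (S.sD S.su) h0 h1
    rw [S.D_exp S.su h0 h1, S.H_exp S.su h0 h1] at eH
    have hE := exp_pos (u ξ t)
    have eDD : Ds ρ (Ds ρ u) ξ t = - Ds ρ u ξ t ^ 2 := by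
      have : exp (u ξ t) * (Ds ρ (Ds ρ u) ξ t + Ds ρ u ξ t ^ 2) = 0 := by linarith
      have := (mul_eq_zero.1 this).resolve_left hE.ne'
      linarith
    apply neg_of_E (E := u ξ t)
    rw [hD, eH, eDD]
    have n0 := S.N0u (ξ := ξ) h0 h1
    have n1 := S.N1u (ξ := ξ) h0 h1
    have hA0 := exp_pos (4 * w ξ t)
    calc _ = 2 * q1 ρ u u ξ t * (exp (u ξ t) ^ 3 * Hop ρ u w (Ds ρ u) ξ t
          + q1 ρ u u ξ t * (exp (u ξ t) ^ 2 * Hop ρ u w u ξ t) + q1 ρ u u ξ t ^ 3) := by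
          simp only [q1]; ring
      _ < 0 := by
        rw [n0, n1]
        generalize exp (4 * w ξ t) = A at *
        generalize q1 ρ u u ξ t = p at *
        generalize q1 ρ u w ξ t = r at *
        have k1 := sq_nonneg ((p - r) * p - 2 * A)
        have k2 : 0 < A * (p * p - 4 / 3 * A) := mul_pos hA0 (by linarith)
        nlinarith)
  refine ⟨K + 1, ?_, fun ξ t h2 h1 => ?_⟩
  · linarith [exp_pos (4 * W)]
  have := h ξ t h2 h1
  have := exp_pos (4 * W)
  apply abs_le_of_sq_le_sq _ (by linarith)
  nlinarith

lemma explip (x : ℝ) : |exp x - 1| ≤ |x| * exp |x| := by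
  have h1 := Real.add_one_le_exp x
  have h2 := Real.add_one_le_exp (-x)
  have h3 : exp x * exp (-x) = 1 := by rw [← exp_add]; simp
  have h4 := exp_pos x
  have h5 : exp x - 1 ≤ x * exp x := by nlinarith
  rcases le_total 0 x with h | h
  · rw [abs_of_nonneg h, abs_of_nonneg (by linarith)]; exact h5
  · rw [abs_of_nonpos h, abs_of_nonpos (by nlinarith)]
    have : 1 ≤ exp (-x) := Real.one_le_exp (by linarith)
    nlinarith

/-- collected zeroth and first order bounds -/
structure Bd (T : ℝ) (ρ u w : ℝ → ℝ → ℝ) (α M : ℝ) : Prop where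
  a0 : 0 < α
  a1 : α ≤ 1 / 2
  m1 : 1 ≤ M
  bu : ∀ ξ t, T / 2 ≤ t → t < T → u ξ t ≤ M
  bE : ∀ ξ t, T / 2 ≤ t → t < T → exp (2 * α * u ξ t) ≤ M
  b2 : ∀ ξ t, T / 2 ≤ t → t < T → exp (2 * w ξ t) ≤ M
  b4 : ∀ ξ t, T / 2 ≤ t → t < T → exp (4 * w ξ t) ≤ M
  d2 : ∀ ξ t, T / 2 ≤ t → t < T → |exp (2 * w ξ t) - exp (4 * w ξ t)| ≤ M * |w ξ t|
  d4 : ∀ ξ t, T / 2 ≤ t → t < T → |exp (4 * w ξ t) - 1| ≤ M * |w ξ t|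
  bp : ∀ ξ t, T / 2 ≤ t → t < T → |q1 ρ u u ξ t| ≤ M
  bw : ∀ ξ t, T / 2 ≤ t → t < T → exp (-2 * α * u ξ t) * w ξ t ^ 2 ≤ M

set_option maxHeartbeats 1000000 in
lemma S3 (S : Sys T ρ u w) : ∃ α M, Bd T ρ u w α M := by
  obtain ⟨U, hU⟩ := S.S0
  obtain ⟨W, hW⟩ := S.S1
  obtain ⟨P, hP0, hP⟩ := S.S2
  set B := exp (4 * W) with hB
  have hBp : 0 < B := exp_pos _
  set c := 16 * exp (-4 * W) with hc
  have hcp : 0 < c := by positivity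
  set α := min (1 / 2) (c / (2 * (12 * P ^ 2 + 4 * B))) with hα
  have hden : 0 < 12 * P ^ 2 + 4 * B := by positivity
  have ha0 : 0 < α := lt_min (by norm_num) (by positivity)
  have ha1 : α ≤ 1 / 2 := min_le_left _ _
  have ha2 : α * (12 * P ^ 2 + 4 * B) < c := by
    have : α ≤ c / (2 * (12 * P ^ 2 + 4 * B)) := min_le_right _ _
    rw [le_div_iff₀ (by positivity)] at this
    nlinarith
  have sθ : Sm T (fun x t => exp (-2 * α * u x t)) := ((Sm.const T (-2 * α)).mul S.su).exp
  obtain ⟨K, hK, h⟩ := S.mp (sθ.mul (S.sw.mul S.sw)) 0 (fun ξ t h2 h1 hp _ => by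
    have h0 : 0 < t := by linarith [S.hT]
    have hw := hW ξ t h2.le h1
    have hA : exp (4 * w ξ t) ≤ B := by
      rw [hB, exp_le_exp]; linarith [le_abs_self (w ξ t)]
    have hpp : q1 ρ u u ξ t ^ 2 ≤ P ^ 2 := sq_le_sq' (by linarith [abs_le.1 (hP ξ t h2.le h1)])
      (abs_le.1 (hP ξ t h2.le h1)).2
    apply neg_of_E (E := u ξ t)
    have hwt := S.weight S.sw (-2 * α) (ξ := ξ) h0 h1
    have hE : exp (2 * u ξ t) = exp (u ξ t) ^ 2 := by rw [← Real.exp_nat_mul]; norm_num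
    rw [hE, S.N0w h0 h1] at hwt
    refine lt_of_le_of_lt hwt (mul_neg_of_pos_of_neg (exp_pos _) ?_)
    have hw2 : 0 < w ξ t ^ 2 := by
      have := exp_pos (-2 * α * u ξ t)
      by_contra! hh
      have : w ξ t * w ξ t = 0 := by nlinarith [sq_nonneg (w ξ t)]
      rw [this] at hp; simp at hp
    have e4 : exp (4 * w ξ t) = exp (2 * w ξ t) * exp (2 * w ξ t) := by rw [← exp_add]; ring_nf
    have k1 : 2 * w ξ t * (4 * exp (2 * w ξ t) - 4 * exp (4 * w ξ t)) ≤ -c * w ξ t ^ 2 := by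
      have h3 := wineq (w ξ t)
      have h4 := mul_le_mul_of_nonneg_left h3 (exp_pos (2 * w ξ t)).le
      have h5 : exp (-4 * W) ≤ exp (2 * w ξ t) * exp (-2 * |w ξ t|) := by
        rw [← exp_add, exp_le_exp]; linarith [neg_abs_le (w ξ t)]
      have h6 := mul_le_mul_of_nonneg_right h5 hw2.le
      rw [e4, hc]
      nlinarith
    have k2 : |(-2 : ℝ) * α| = 2 * α := by rw [abs_mul, abs_of_pos ha0]; norm_num
    have k3 : 0 ≤ exp (u ξ t) ^ 2 * Ds ρ w ξ t ^ 2 := by positivity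
    rw [k2]
    have k4 : 3 * (-2 * α) ^ 2 * (exp (u ξ t) * Ds ρ u ξ t) ^ 2 + 2 * (2 * α) * exp (4 * w ξ t)
        ≤ α * (12 * P ^ 2 + 4 * B) := by
      change 3 * (-2 * α) ^ 2 * (q1 ρ u u ξ t) ^ 2 + _ ≤ _
      have i1 : α ^ 2 * q1 ρ u u ξ t ^ 2 ≤ α * P ^ 2 := by
        apply mul_le_mul (by nlinarith) hpp (sq_nonneg _) ha0.le
      nlinarith
    have k5 := mul_le_mul_of_nonneg_right k4 hw2.le
    have k6 := mul_lt_mul_of_pos_right ha2 hw2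
    linarith)
  have expw : ∀ ξ t, T / 2 ≤ t → t < T → exp (4 * |w ξ t|) ≤ B := fun ξ t h2 h1 => by
    rw [hB, exp_le_exp]; linarith [hW ξ t h2 h1]
  refine ⟨α, 1 + |U| + exp (2 * α * U) + 5 * B + B * B + P + K, ?_⟩
  have j1 : 0 < exp (2 * α * U) := exp_pos _
  have j2 := abs_nonneg U
  have j3 : 0 < B * B := by positivity
  have e2a : ∀ ξ t, T / 2 ≤ t → t < T → exp (2 * w ξ t) ≤ B := fun ξ t h2 h1 =>
    le_trans (exp_le_exp.2 (by linarith [le_abs_self (w ξ t), abs_nonneg (w ξ t)]))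
      (expw ξ t h2 h1)
  refine ⟨ha0, ha1, by linarith, fun ξ t h2 h1 => ?_, fun ξ t h2 h1 => ?_, fun ξ t h2 h1 => ?_,
    fun ξ t h2 h1 => ?_, fun ξ t h2 h1 => ?_, fun ξ t h2 h1 => ?_, fun ξ t h2 h1 => ?_,
    fun ξ t h2 h1 => ?_⟩
  · linarith [hU ξ t h2 h1, le_abs_self U]
  · have : exp (2 * α * u ξ t) ≤ exp (2 * α * U) := by
      rw [exp_le_exp]; exact mul_le_mul_of_nonneg_left (hU ξ t h2 h1) (by linarith)
    linarith
  · linarith [e2a ξ t h2 h1]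
  · have : exp (4 * w ξ t) ≤ B :=
      le_trans (exp_le_exp.2 (by linarith [le_abs_self (w ξ t)])) (expw ξ t h2 h1)
    linarith
  · have e4 : exp (4 * w ξ t) = exp (2 * w ξ t) * exp (2 * w ξ t) := by rw [← exp_add]; ring_nf
    have : exp (2 * w ξ t) - exp (4 * w ξ t) = - (exp (2 * w ξ t) * (exp (2 * w ξ t) - 1)) := by
      rw [e4]; ring
    rw [this, abs_neg, abs_mul, abs_of_pos (exp_pos _)]
    have l := explip (2 * w ξ t)
    have ab : |2 * w ξ t| = 2 * |w ξ t| := by rw [abs_mul]; norm_num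
    rw [ab] at l
    have l2 : exp (2 * w ξ t) * exp (2 * |w ξ t|) ≤ B := by
      rw [← exp_add]
      exact le_trans (exp_le_exp.2 (by linarith [le_abs_self (w ξ t)])) (expw ξ t h2 h1)
    have l3 := mul_le_mul_of_nonneg_left l (exp_pos (2 * w ξ t)).le
    have l4 := mul_le_mul_of_nonneg_right l2 (abs_nonneg (w ξ t))
    have l6 : exp (2 * w ξ t) * |exp (2 * w ξ t) - 1| ≤ 2 * (B * |w ξ t|) := by
      refine l3.trans (le_trans (le_of_eq ?_) (mul_le_mul_of_nonneg_left l4 zero_le_two))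
      ring
    refine l6.trans ?_
    rw [← mul_assoc]
    exact mul_le_mul_of_nonneg_right (by linarith) (abs_nonneg _)
  · have l := explip (4 * w ξ t)
    have ab : |4 * w ξ t| = 4 * |w ξ t| := by rw [abs_mul]; norm_num
    rw [ab] at l
    have l4 := mul_le_mul_of_nonneg_right (expw ξ t h2 h1) (abs_nonneg (w ξ t))
    have l6 : |exp (4 * w ξ t) - 1| ≤ 4 * (B * |w ξ t|) := by
      refine l.trans (le_trans (le_of_eq ?_) (mul_le_mul_of_nonneg_left l4 zero_le_four))
      ring
    refine l6.trans ?_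
    rw [← mul_assoc]
    exact mul_le_mul_of_nonneg_right (by linarith) (abs_nonneg _)
  · linarith [hP ξ t h2 h1]
  · have := h ξ t h2 h1
    have e : exp (-2 * α * u ξ t) * w ξ t ^ 2 = exp (-2 * α * u ξ t) * (w ξ t * w ξ t) := by ring
    rw [e]
    linarith

end Sys

namespace Sys
variable {T : ℝ} {ρ u w φ ψ : ℝ → ℝ → ℝ} {α M : ℝ}

lemma Bd.mono {M' : ℝ} (B : Bd T ρ u w α M) (h : M ≤ M') : Bd T ρ u w α M' where
  a0 := B.a0
  a1 := B.a1
  m1 := B.m1.trans h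
  bu ξ t h2 h1 := (B.bu ξ t h2 h1).trans h
  bE ξ t h2 h1 := (B.bE ξ t h2 h1).trans h
  b2 ξ t h2 h1 := (B.b2 ξ t h2 h1).trans h
  b4 ξ t h2 h1 := (B.b4 ξ t h2 h1).trans h
  d2 ξ t h2 h1 := (B.d2 ξ t h2 h1).trans (mul_le_mul_of_nonneg_right h (abs_nonneg _))
  d4 ξ t h2 h1 := (B.d4 ξ t h2 h1).trans (mul_le_mul_of_nonneg_right h (abs_nonneg _))
  bp ξ t h2 h1 := (B.bp ξ t h2 h1).trans h
  bw ξ t h2 h1 := (B.bw ξ t h2 h1).trans h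

lemma weight' (S : Sys T ρ u w) (B : Bd T ρ u w α M) (h : Sm T φ) (m : ℝ) (hm : |m| ≤ 4)
    {ξ t : ℝ} (h2 : T / 2 ≤ t) (h1 : t < T) :
    exp (u ξ t) ^ 2 * Hop ρ u w (fun x t => exp (m * u x t) * (φ x t * φ x t)) ξ t ≤
      exp (m * u ξ t) * (2 * φ ξ t * (exp (u ξ t) ^ 2 * Hop ρ u w φ ξ t)
        - exp (u ξ t) ^ 2 * (Ds ρ φ ξ t) ^ 2 + 56 * M ^ 2 * φ ξ t ^ 2) := by
  have h0 : 0 < t := by linarith [S.hT]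
  have hw := S.weight h m (ξ := ξ) h0 h1
  have hE : exp (2 * u ξ t) = exp (u ξ t) ^ 2 := by rw [← Real.exp_nat_mul]; norm_num
  rw [hE] at hw
  refine hw.trans (mul_le_mul_of_nonneg_left ?_ (exp_pos _).le)
  have hM := B.m1
  have k : 3 * m ^ 2 * (exp (u ξ t) * Ds ρ u ξ t) ^ 2 + 2 * |m| * exp (4 * w ξ t) ≤ 56 * M ^ 2 := by
    change 3 * m ^ 2 * (q1 ρ u u ξ t) ^ 2 + _ ≤ _
    have i1 : q1 ρ u u ξ t ^ 2 ≤ M ^ 2 := sq_le_sq' (by linarith [abs_le.1 (B.bp ξ t h2 h1)])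
      (abs_le.1 (B.bp ξ t h2 h1)).2
    have i2 : m ^ 2 ≤ 16 := by nlinarith [abs_le.1 hm]
    have i3 : m ^ 2 * q1 ρ u u ξ t ^ 2 ≤ 16 * M ^ 2 :=
      mul_le_mul i2 i1 (sq_nonneg _) (by norm_num)
    have i4 : |m| * exp (4 * w ξ t) ≤ 4 * M :=
      mul_le_mul hm (B.b4 ξ t h2 h1) (exp_pos _).le (by norm_num)
    nlinarith
  have := mul_le_mul_of_nonneg_right k (sq_nonneg (φ ξ t))
  linarith

lemma expm (α x : ℝ) : exp ((2 - 2 * α) * x) = exp (-2 * α * x) * exp x ^ 2 := by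
  rw [← Real.exp_nat_mul, ← exp_add]; ring_nf
lemma expm4 (α x : ℝ) : exp ((4 - 2 * α) * x) = exp (-2 * α * x) * exp x ^ 4 := by
  rw [← Real.exp_nat_mul, ← exp_add]; ring_nf

lemma young (a b : ℝ) : |a| * |b| ≤ (a ^ 2 + b ^ 2) / 2 := by
  nlinarith [sq_nonneg (|a| - |b|), sq_abs a, sq_abs b]

lemma realA {A2 A4 p r w M : ℝ} (hM : 1 ≤ M) (h2 : A2 ≤ M) (h4 : 0 ≤ A4)
    (hd : |A2 - A4| ≤ M * |w|) (hp : |p| ≤ M) :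
    2 * r * (4 * A2 * (2 * r - 2 * p) - 4 * A4 * (4 * r - 2 * p)
      - (p ^ 2 + 2 * (p - r) ^ 2) * r) ≤ 24 * M ^ 2 * (r ^ 2 + w ^ 2) := by
  have i1 : -16 * ((A2 - A4) * p * r) ≤ 16 * (M * |w| * M * |r|) := by
    have : |(A2 - A4) * p * r| ≤ M * |w| * M * |r| := by
      rw [abs_mul, abs_mul]; gcongr
    linarith [neg_abs_le ((A2 - A4) * p * r)]
  have i2 := young w r
  have i3 : M ^ 2 * (|w| * |r|) ≤ M ^ 2 * ((w ^ 2 + r ^ 2) / 2) := by gcongr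
  have i4 : A2 * r ^ 2 ≤ M ^ 2 * r ^ 2 := by
    gcongr; nlinarith
  have i5 : 0 ≤ A4 * r ^ 2 := by positivity
  have i6 : 0 ≤ (p ^ 2 + 2 * (p - r) ^ 2) * r ^ 2 := by positivity
  have i7 : 0 ≤ M ^ 2 * w ^ 2 := by positivity
  nlinarith

lemma wA (S : Sys T ρ u w) (B : Bd T ρ u w α M) {ξ t : ℝ} (h2 : T / 2 ≤ t) (h1 : t < T) :
    exp (u ξ t) ^ 2 * Hop ρ u w (fun x t => exp ((2 - 2 * α) * u x t) *
      (Ds ρ w x t * Ds ρ w x t)) ξ t ≤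
      exp (-2 * α * u ξ t) * (-q2 ρ u w ξ t ^ 2
        + 80 * M ^ 2 * (q1 ρ u w ξ t ^ 2 + w ξ t ^ 2)) := by
  have h0 : 0 < t := by linarith [S.hT]
  have hm : |2 - 2 * α| ≤ 4 := by rw [abs_le]; constructor <;> linarith [B.a0, B.a1]
  have k := S.weight' B (S.sD S.sw) _ hm (ξ := ξ) h2 h1
  rw [expm] at k
  refine k.trans ?_
  rw [mul_assoc]
  refine mul_le_mul_of_nonneg_left ?_ (exp_pos _).le
  have n := S.N1w (ξ := ξ) h0 h1
  have r := realA (r := q1 ρ u w ξ t) B.m1 (B.b2 ξ t h2 h1) (exp_pos _).le (B.d2 ξ t h2 h1)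
    (B.bp ξ t h2 h1)
  rw [← n] at r
  have e : exp (u ξ t) ^ 2 * (2 * Ds ρ w ξ t * (exp (u ξ t) ^ 2 * Hop ρ u w (Ds ρ w) ξ t)
      - exp (u ξ t) ^ 2 * Ds ρ (Ds ρ w) ξ t ^ 2 + 56 * M ^ 2 * Ds ρ w ξ t ^ 2)
      = 2 * q1 ρ u w ξ t * (exp (u ξ t) ^ 3 * Hop ρ u w (Ds ρ w) ξ t) - q2 ρ u w ξ t ^ 2
        + 56 * M ^ 2 * q1 ρ u w ξ t ^ 2 := by simp only [q1, q2]; ring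
  rw [e]
  have : 0 ≤ M ^ 2 * w ξ t ^ 2 := by positivity
  nlinarith

lemma wB (S : Sys T ρ u w) (B : Bd T ρ u w α M) {ξ t : ℝ} (h2 : T / 2 ≤ t) (h1 : t < T) :
    exp (u ξ t) ^ 2 * Hop ρ u w (fun x t => exp (-2 * α * u x t) * (w x t * w x t)) ξ t ≤
      exp (-2 * α * u ξ t) * (-q1 ρ u w ξ t ^ 2 + 56 * M ^ 2 * w ξ t ^ 2) := by
  have h0 : 0 < t := by linarith [S.hT]
  have hm : |-2 * α| ≤ 4 := by rw [abs_le]; constructor <;> linarith [B.a0, B.a1]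
  have k := S.weight' B S.sw _ hm (ξ := ξ) h2 h1
  refine k.trans ?_
  refine mul_le_mul_of_nonneg_left ?_ (exp_pos _).le
  rw [S.N0w (ξ := ξ) h0 h1]
  have e4 : exp (4 * w ξ t) = exp (2 * w ξ t) * exp (2 * w ξ t) := by rw [← exp_add]; ring_nf
  have h3 := wineq (w ξ t)
  have h4 : 0 ≤ exp (-2 * |w ξ t|) * (w ξ t) ^ 2 := by positivity
  have h8 := mul_nonneg (exp_pos (2 * w ξ t)).le
    (show 0 ≤ -(w ξ t * (1 - exp (2 * w ξ t))) by linarith)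
  rw [e4]
  simp only [q1]
  nlinarith

lemma S4 (S : Sys T ρ u w) (B : Bd T ρ u w α M) :
    ∃ K, ∀ ξ t, T / 2 ≤ t → t < T → exp (-2 * α * u ξ t) * q1 ρ u w ξ t ^ 2 ≤ K := by
  set N := 80 * M ^ 2 + 1 with hN
  have hM := B.m1
  have hN0 : 0 < N := by positivity
  set C := 80 * M ^ 2 + 56 * N * M ^ 2 with hC
  have hC0 : 0 < C := by positivity
  have sθ : Sm T (fun x t => exp (-2 * α * u x t)) := ((Sm.const T (-2 * α)).mul S.su).exp
  have sθ2 : Sm T (fun x t => exp ((2 - 2 * α) * u x t)) :=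
    ((Sm.const T (2 - 2 * α)).mul S.su).exp
  have s1 := sθ2.mul ((S.sD S.sw).mul (S.sD S.sw))
  have s2 := sθ.mul (S.sw.mul S.sw)
  have val : ∀ ξ t, exp ((2 - 2 * α) * u ξ t) * (Ds ρ w ξ t * Ds ρ w ξ t)
      = exp (-2 * α * u ξ t) * q1 ρ u w ξ t ^ 2 := fun ξ t => by
    rw [expm]; simp only [q1]; ring
  obtain ⟨K, hK, h⟩ := S.mp (s1.add ((Sm.const T N).mul s2)) (N * M + C * M)
    (fun ξ t h2 h1 hp _ => by
    have h0 : 0 < t := by linarith [S.hT]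
    apply neg_of_E (E := u ξ t)
    rw [S.H_add s1 ((Sm.const T N).mul s2) h0 h1, S.H_cmul s2 N h0 h1]
    have a := S.wA B (ξ := ξ) h2.le h1
    have b := mul_le_mul_of_nonneg_left (S.wB B (ξ := ξ) h2.le h1) hN0.le
    simp only [val] at hp
    have hb := B.bw ξ t h2.le h1
    have hθ := exp_pos (-2 * α * u ξ t)
    have hNb := mul_le_mul_of_nonneg_left hb hN0.le
    have hCb := mul_le_mul_of_nonneg_left hb hC0.le
    have key : exp (-2 * α * u ξ t) * (-q2 ρ u w ξ t ^ 2
        + 80 * M ^ 2 * (q1 ρ u w ξ t ^ 2 + w ξ t ^ 2)) +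
        N * (exp (-2 * α * u ξ t) * (-q1 ρ u w ξ t ^ 2 + 56 * M ^ 2 * w ξ t ^ 2))
        = - (exp (-2 * α * u ξ t) * q2 ρ u w ξ t ^ 2)
          - exp (-2 * α * u ξ t) * q1 ρ u w ξ t ^ 2
          + C * (exp (-2 * α * u ξ t) * w ξ t ^ 2) := by rw [hC, hN]; ring
    have y0 : 0 ≤ exp (-2 * α * u ξ t) * q2 ρ u w ξ t ^ 2 := by positivity
    nlinarith)
  refine ⟨K, fun ξ t h2 h1 => ?_⟩
  have := h ξ t h2 h1
  simp only [val] at this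
  have h5 : 0 ≤ N * (exp (-2 * α * u ξ t) * (w ξ t * w ξ t)) :=
    mul_nonneg hN0.le (mul_nonneg (exp_pos _).le (mul_self_nonneg _))
  linarith

end Sys

namespace Sys
variable {T : ℝ} {ρ u w φ ψ : ℝ → ℝ → ℝ} {α M : ℝ}

/-- first order bounds including the derivative of `w` -/
structure Bd2 (T : ℝ) (ρ u w : ℝ → ℝ → ℝ) (α M : ℝ) : Prop where
  b : Bd T ρ u w α M
  br : ∀ ξ t, T / 2 ≤ t → t < T → exp (-2 * α * u ξ t) * q1 ρ u w ξ t ^ 2 ≤ M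

lemma S4' (S : Sys T ρ u w) : ∃ α M, Bd2 T ρ u w α M := by
  obtain ⟨α, M, B⟩ := S.S3
  obtain ⟨K, h⟩ := S.S4 B
  refine ⟨α, max M K, B.mono (le_max_left _ _), fun ξ t h2 h1 => (h ξ t h2 h1).trans (le_max_right _ _)⟩

lemma unθ (B : Bd T ρ u w α M) {x : ℝ} {ξ t : ℝ} (h2 : T / 2 ≤ t) (h1 : t < T) :
    x ^ 2 ≤ M * (exp (-2 * α * u ξ t) * x ^ 2) := by
  have h := B.bE ξ t h2 h1
  have e : exp (2 * α * u ξ t) * exp (-2 * α * u ξ t) = 1 := by rw [← exp_add]; ring_nf; simp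
  have k : 0 ≤ exp (-2 * α * u ξ t) * x ^ 2 := by positivity
  calc x ^ 2 = exp (2 * α * u ξ t) * (exp (-2 * α * u ξ t) * x ^ 2) := by rw [← mul_assoc, e, one_mul]
    _ ≤ _ := mul_le_mul_of_nonneg_right h k

lemma unθ' (B : Bd T ρ u w α M) {x : ℝ} {ξ t : ℝ} (h2 : T / 2 ≤ t) (h1 : t < T)
    (h : exp (-2 * α * u ξ t) * x ^ 2 ≤ M) : |x| ≤ M := by
  have hM := B.m1
  apply abs_le_of_sq_le_sq _ (by linarith)
  have := unθ B (x := x) (ξ := ξ) h2 h1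
  nlinarith

lemma realU {A4 p r η y M : ℝ} (hM : 1 ≤ M) (h40 : 0 ≤ A4) (h4 : A4 ≤ M) (hp : |p| ≤ M)
    (hr : |r| ≤ M) :
    2 * η * (-2 * A4 * ((4 * r - 2 * p) ^ 2 + (4 * y - 2 * η))
      - 2 * (p ^ 2 + 2 * (p - r) ^ 2) * η
      - (2 * p * η + 4 * (p - r) * (η - y)) * p) ≤ 288 * M ^ 3 * (1 + η ^ 2 + y ^ 2) := by
  obtain ⟨p1, p2⟩ := abs_le.1 hp
  obtain ⟨r1, r2⟩ := abs_le.1 hr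
  have hb : |p - r| ≤ 2 * M := by rw [abs_le]; constructor <;> linarith
  have hpr : |p * (p - r)| ≤ 2 * M ^ 2 := by
    rw [abs_mul]; nlinarith [abs_nonneg p, abs_nonneg (p - r)]
  have c1 : (4 * r - 2 * p) ^ 2 ≤ 36 * M ^ 2 := by nlinarith
  have hM3 : M ^ 2 ≤ M ^ 3 := pow_le_pow_right₀ hM (by norm_num)
  have hM2 : M ≤ M ^ 2 := by nlinarith
  have a1 : |A4| ≤ M := by rwa [abs_of_nonneg h40]
  have t1 : |-4 * (A4 * (4 * r - 2 * p) ^ 2 * η)| ≤ 4 * (M * (36 * M ^ 2) * |η|) := by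
    rw [abs_mul, abs_mul, abs_mul, abs_of_nonneg (sq_nonneg (4 * r - 2 * p))]
    norm_num; gcongr
  have t2 : |-16 * (A4 * y * η)| ≤ 16 * (M * |y| * |η|) := by
    rw [abs_mul, abs_mul, abs_mul]; norm_num; gcongr
  have t3 : A4 * η ^ 2 ≤ M * η ^ 2 := by gcongr
  have t4 : |-8 * (p * (p - r) * η * η)| ≤ 8 * (M * (2 * M) * |η| * |η|) := by
    rw [abs_mul, abs_mul, abs_mul, abs_mul]; norm_num; gcongr
  have t5 : |8 * (p * (p - r) * y * η)| ≤ 8 * (M * (2 * M) * |y| * |η|) := by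
    rw [abs_mul, abs_mul, abs_mul, abs_mul]; norm_num; gcongr
  have t6 : 0 ≤ 4 * (p ^ 2 + 2 * (p - r) ^ 2) * η ^ 2 + 4 * p ^ 2 * η ^ 2 := by positivity
  have y1 := young y η
  have y2 := young 1 η
  have y3 := young η η
  rw [abs_one] at y2
  have u1 := (le_abs_self _).trans t1
  have u2 := (le_abs_self _).trans t2
  have u4 := (le_abs_self _).trans t4
  have u5 := (le_abs_self _).trans t5
  have v1 : M ^ 3 * |η| ≤ M ^ 3 * ((1 + η ^ 2) / 2) := by gcongr; linarith
  have v2 : M * (|y| * |η|) ≤ M ^ 3 * ((y ^ 2 + η ^ 2) / 2) := by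
    apply mul_le_mul (by linarith) y1 (by positivity) (by positivity)
  have v3 : M ^ 2 * (|y| * |η|) ≤ M ^ 3 * ((y ^ 2 + η ^ 2) / 2) := by
    apply mul_le_mul (by linarith) y1 (by positivity) (by positivity)
  have v4 : M ^ 2 * (|η| * |η|) ≤ M ^ 3 * ((η ^ 2 + η ^ 2) / 2) := by
    apply mul_le_mul (by linarith) y3 (by positivity) (by positivity)
  have v5 : M * η ^ 2 ≤ M ^ 3 * η ^ 2 := by gcongr; linarith
  have z0 : 0 ≤ M ^ 3 := by positivity
  have z1 : 0 ≤ M ^ 3 * η ^ 2 := by positivity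
  have z2 : 0 ≤ M ^ 3 * y ^ 2 := by positivity
  nlinarith

set_option maxHeartbeats 1000000 in
lemma realW {A2 A4 p r η y w M : ℝ} (hM : 1 ≤ M) (h20 : 0 ≤ A2) (h2 : A2 ≤ M)
    (h40 : 0 ≤ A4) (h4 : A4 ≤ M) (hd : |A2 - A4| ≤ M * |w|) (hp : |p| ≤ M)
    (hr : |r| ≤ M) :
    2 * y * (4 * A2 * ((2 * r - 2 * p) ^ 2 + (2 * y - 2 * η))
      - 4 * A4 * ((4 * r - 2 * p) ^ 2 + (4 * y - 2 * η))
      - 2 * (p ^ 2 + 2 * (p - r) ^ 2) * y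
      - (2 * p * η + 4 * (p - r) * (η - y)) * r) ≤
      1200 * M ^ 3 * y ^ 2 + 400 * M ^ 3 * ((w ^ 2 + r ^ 2) * (1 + η ^ 2)) := by
  obtain ⟨p1, p2⟩ := abs_le.1 hp
  obtain ⟨r1, r2⟩ := abs_le.1 hr
  have hb : |p - r| ≤ 2 * M := by rw [abs_le]; constructor <;> linarith
  have hM3 : M ^ 2 ≤ M ^ 3 := pow_le_pow_right₀ hM (by norm_num)
  have hM2 : M ≤ M ^ 2 := by nlinarith
  have a1 : |A4| ≤ M := by rwa [abs_of_nonneg h40]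
  have a2 : |A2| ≤ M := by rwa [abs_of_nonneg h20]
  have e : 2 * y * (4 * A2 * ((2 * r - 2 * p) ^ 2 + (2 * y - 2 * η))
      - 4 * A4 * ((4 * r - 2 * p) ^ 2 + (4 * y - 2 * η))
      - 2 * (p ^ 2 + 2 * (p - r) ^ 2) * y
      - (2 * p * η + 4 * (p - r) * (η - y)) * r) =
      32 * ((A2 - A4) * p * p * y) + (-16) * ((A2 - A4) * η * y)
      + (-64) * (A2 * p * r * y) + 32 * (A2 * r * r * y) + 16 * (A2 * y ^ 2)
      + 128 * (A4 * p * r * y) + (-128) * (A4 * r * r * y) - 32 * (A4 * y ^ 2)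
      - 4 * (p ^ 2 + 2 * (p - r) ^ 2) * y ^ 2 + (-4) * (p * r * η * y)
      + (-8) * ((p - r) * r * η * y) + 8 * ((p - r) * r * y * y) := by ring
  have t1 : |32 * ((A2 - A4) * p * p * y)| ≤ 32 * (M * |w| * M * M * |y|) := by
    simp only [abs_mul]; norm_num; gcongr
  have t2 : |(-16) * ((A2 - A4) * η * y)| ≤ 16 * (M * |w| * |η| * |y|) := by
    simp only [abs_mul]; norm_num; gcongr
  have t3 : |(-64) * (A2 * p * r * y)| ≤ 64 * (M * M * |r| * |y|) := by
    simp only [abs_mul]; norm_num; gcongr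
  have t4 : |32 * (A2 * r * r * y)| ≤ 32 * (M * M * |r| * |y|) := by
    simp only [abs_mul]; norm_num; gcongr
  have t5 : A2 * y ^ 2 ≤ M * y ^ 2 := by gcongr
  have t6 : |128 * (A4 * p * r * y)| ≤ 128 * (M * M * |r| * |y|) := by
    simp only [abs_mul]; norm_num; gcongr
  have t7 : |(-128) * (A4 * r * r * y)| ≤ 128 * (M * M * |r| * |y|) := by
    simp only [abs_mul]; norm_num; gcongr
  have t8 : |(-4) * (p * r * η * y)| ≤ 4 * (M * |r| * |η| * |y|) := by
    simp only [abs_mul]; norm_num; gcongr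
  have t9 : |(-8) * ((p - r) * r * η * y)| ≤ 8 * (2 * M * |r| * |η| * |y|) := by
    rw [abs_mul, abs_mul, abs_mul, abs_mul]; norm_num; gcongr
  have t10 : |8 * ((p - r) * r * y * y)| ≤ 8 * (2 * M * M * |y| * |y|) := by
    rw [abs_mul, abs_mul, abs_mul, abs_mul]; norm_num; gcongr
  have s1 : 0 ≤ A4 * y ^ 2 := by positivity
  have s2 : 0 ≤ 4 * (p ^ 2 + 2 * (p - r) ^ 2) * y ^ 2 := by positivity
  have z : 0 ≤ M ^ 3 := by positivity
  have W1 : M ^ 3 * (|w| * |y|) ≤ M ^ 3 * ((w ^ 2 + y ^ 2) / 2) := by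
    gcongr; exact young w y
  have W2 : M * (|w| * |η| * |y|) ≤ M ^ 3 * (((w * η) ^ 2 + y ^ 2) / 2) := by
    rw [← abs_mul w η]
    exact mul_le_mul (by linarith) (young _ _) (by positivity) z
  have W3 : M ^ 2 * (|r| * |y|) ≤ M ^ 3 * ((r ^ 2 + y ^ 2) / 2) := by
    exact mul_le_mul (by linarith) (young _ _) (by positivity) z
  have W4 : M * (|r| * |η| * |y|) ≤ M ^ 3 * (((r * η) ^ 2 + y ^ 2) / 2) := by
    rw [← abs_mul r η]
    exact mul_le_mul (by linarith) (young _ _) (by positivity) z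
  have W5 : M ^ 2 * (|y| * |y|) ≤ M ^ 3 * ((y ^ 2 + y ^ 2) / 2) := by
    exact mul_le_mul (by linarith) (young _ _) (by positivity) z
  have W6 : M * y ^ 2 ≤ M ^ 3 * y ^ 2 := by gcongr; linarith
  have u1 := (le_abs_self _).trans t1
  have u2 := (le_abs_self _).trans t2
  have u3 := (le_abs_self _).trans t3
  have u4 := (le_abs_self _).trans t4
  have u6 := (le_abs_self _).trans t6
  have u7 := (le_abs_self _).trans t7
  have u8 := (le_abs_self _).trans t8
  have u9 := (le_abs_self _).trans t9
  have u10 := (le_abs_self _).trans t10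
  have z1 : 0 ≤ M ^ 3 * w ^ 2 := by positivity
  have z2 : 0 ≤ M ^ 3 * y ^ 2 := by positivity
  have z3 : 0 ≤ M ^ 3 * r ^ 2 := by positivity
  have z4 : 0 ≤ M ^ 3 * (w * η) ^ 2 := by positivity
  have z5 : 0 ≤ M ^ 3 * (r * η) ^ 2 := by positivity
  rw [e]
  linarith

lemma realP {A4 p r M : ℝ} (hM : 1 ≤ M) (h40 : 0 ≤ A4) (h4 : A4 ≤ M) (hp : |p| ≤ M)
    (hr : |r| ≤ M) :
    2 * p * (-2 * A4 * (4 * r - 2 * p) - (p ^ 2 + 2 * (p - r) ^ 2) * p) ≤ 24 * M ^ 4 := by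
  have a1 : |A4| ≤ M := by rwa [abs_of_nonneg h40]
  have t1 : |(-16) * (A4 * p * r)| ≤ 16 * (M * M * M) := by
    simp only [abs_mul]; norm_num; gcongr
  have t2 : |8 * (A4 * p * p)| ≤ 8 * (M * M * M) := by
    simp only [abs_mul]; norm_num; gcongr
  have s2 : 0 ≤ 2 * (p ^ 2 + 2 * (p - r) ^ 2) * p ^ 2 := by positivity
  have hM3 : M ^ 3 ≤ M ^ 4 := pow_le_pow_right₀ hM (by norm_num)
  have u1 := (le_abs_self _).trans t1
  have u2 := (le_abs_self _).trans t2
  nlinarith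

lemma wU (S : Sys T ρ u w) (B : Bd2 T ρ u w α M) {ξ t : ℝ} (h2 : T / 2 ≤ t) (h1 : t < T) :
    exp (u ξ t) ^ 2 * Hop ρ u w (fun x t => exp (4 * u x t) *
      (Ds ρ (Ds ρ u) x t * Ds ρ (Ds ρ u) x t)) ξ t ≤
      344 * M ^ 4 * (1 + q2 ρ u u ξ t ^ 2 + exp (-2 * α * u ξ t) * q2 ρ u w ξ t ^ 2) := by
  have h0 : 0 < t := by linarith [S.hT]
  have hM := B.b.m1
  refine (S.weight' B.b (S.sD (S.sD S.su)) 4 (by norm_num) (ξ := ξ) h2 h1).trans ?_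
  have n := S.N2u (ξ := ξ) h0 h1
  have r := realU (r := q1 ρ u w ξ t) (η := q2 ρ u u ξ t) (y := q2 ρ u w ξ t) hM
    (exp_pos (4 * w ξ t)).le (B.b.b4 ξ t h2 h1) (B.b.bp ξ t h2 h1) (unθ' B.b h2 h1 (B.br ξ t h2 h1))
  rw [← n] at r
  have e4 : exp (4 * u ξ t) = exp (u ξ t) ^ 4 := by rw [← Real.exp_nat_mul]; norm_num
  have e : exp (4 * u ξ t) * (2 * Ds ρ (Ds ρ u) ξ t * (exp (u ξ t) ^ 2 *
      Hop ρ u w (Ds ρ (Ds ρ u)) ξ t)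
      - exp (u ξ t) ^ 2 * Ds ρ (Ds ρ (Ds ρ u)) ξ t ^ 2 + 56 * M ^ 2 * Ds ρ (Ds ρ u) ξ t ^ 2)
      = 2 * q2 ρ u u ξ t * (exp (u ξ t) ^ 4 * Hop ρ u w (Ds ρ (Ds ρ u)) ξ t)
        - exp (u ξ t) ^ 6 * Ds ρ (Ds ρ (Ds ρ u)) ξ t ^ 2
        + 56 * M ^ 2 * q2 ρ u u ξ t ^ 2 := by rw [e4]; simp only [q2]; ring
  rw [e]
  have k := unθ B.b (x := q2 ρ u w ξ t) (ξ := ξ) h2 h1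
  have z0 : 0 ≤ exp (-2 * α * u ξ t) * q2 ρ u w ξ t ^ 2 := by positivity
  have k1 : M ^ 3 * q2 ρ u w ξ t ^ 2 ≤ M ^ 4 * (exp (-2 * α * u ξ t) * q2 ρ u w ξ t ^ 2) := by
    calc _ ≤ M ^ 3 * (M * (exp (-2 * α * u ξ t) * q2 ρ u w ξ t ^ 2)) := by gcongr
      _ = _ := by ring
  have hM34 : M ^ 3 ≤ M ^ 4 := pow_le_pow_right₀ hM (by norm_num)
  have hM24 : M ^ 2 ≤ M ^ 4 := pow_le_pow_right₀ hM (by norm_num)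
  have k2 : M ^ 3 * (1 + q2 ρ u u ξ t ^ 2) ≤ M ^ 4 * (1 + q2 ρ u u ξ t ^ 2) := by gcongr
  have k3 : M ^ 2 * q2 ρ u u ξ t ^ 2 ≤ M ^ 4 * q2 ρ u u ξ t ^ 2 := by gcongr
  have z1 : 0 ≤ exp (u ξ t) ^ 6 * Ds ρ (Ds ρ (Ds ρ u)) ξ t ^ 2 := by positivity
  have z2 : 0 ≤ M ^ 4 * (exp (-2 * α * u ξ t) * q2 ρ u w ξ t ^ 2) := by positivity
  have z3 : 0 ≤ M ^ 4 := by positivity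
  nlinarith

lemma wW (S : Sys T ρ u w) (B : Bd2 T ρ u w α M) {ξ t : ℝ} (h2 : T / 2 ≤ t) (h1 : t < T) :
    exp (u ξ t) ^ 2 * Hop ρ u w (fun x t => exp ((4 - 2 * α) * u x t) *
      (Ds ρ (Ds ρ w) x t * Ds ρ (Ds ρ w) x t)) ξ t ≤
      1256 * M ^ 4 * (exp (-2 * α * u ξ t) * q2 ρ u w ξ t ^ 2)
        + 800 * M ^ 4 * (1 + q2 ρ u u ξ t ^ 2) := by
  have h0 : 0 < t := by linarith [S.hT]
  have hM := B.b.m1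
  have hm : |4 - 2 * α| ≤ 4 := by rw [abs_le]; constructor <;> linarith [B.b.a0, B.b.a1]
  refine (S.weight' B.b (S.sD (S.sD S.sw)) _ hm (ξ := ξ) h2 h1).trans ?_
  have n := S.N2w (ξ := ξ) h0 h1
  have r := realW (r := q1 ρ u w ξ t) (η := q2 ρ u u ξ t) (y := q2 ρ u w ξ t) hM
    (exp_pos (2 * w ξ t)).le (B.b.b2 ξ t h2 h1)
    (exp_pos (4 * w ξ t)).le (B.b.b4 ξ t h2 h1) (B.b.d2 ξ t h2 h1)
    (B.b.bp ξ t h2 h1) (unθ' B.b h2 h1 (B.br ξ t h2 h1))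
  rw [← n] at r
  have hθ := exp_pos (-2 * α * u ξ t)
  have bw := B.b.bw ξ t h2 h1
  have br := B.br ξ t h2 h1
  have e : exp ((4 - 2 * α) * u ξ t) * (2 * Ds ρ (Ds ρ w) ξ t * (exp (u ξ t) ^ 2 *
      Hop ρ u w (Ds ρ (Ds ρ w)) ξ t)
      - exp (u ξ t) ^ 2 * Ds ρ (Ds ρ (Ds ρ w)) ξ t ^ 2 + 56 * M ^ 2 * Ds ρ (Ds ρ w) ξ t ^ 2)
      = exp (-2 * α * u ξ t) * (2 * q2 ρ u w ξ t *
        (exp (u ξ t) ^ 4 * Hop ρ u w (Ds ρ (Ds ρ w)) ξ t))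
        - exp (-2 * α * u ξ t) * (exp (u ξ t) ^ 6 * Ds ρ (Ds ρ (Ds ρ w)) ξ t ^ 2)
        + 56 * M ^ 2 * (exp (-2 * α * u ξ t) * q2 ρ u w ξ t ^ 2) := by
    rw [expm4]; simp only [q2]; ring
  rw [e]
  have r' := mul_le_mul_of_nonneg_left r hθ.le
  have z0 : 0 ≤ exp (-2 * α * u ξ t) * q2 ρ u w ξ t ^ 2 := by positivity
  have z1 : 0 ≤ exp (-2 * α * u ξ t) * (exp (u ξ t) ^ 6 * Ds ρ (Ds ρ (Ds ρ w)) ξ t ^ 2) := by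
    positivity
  generalize exp (-2 * α * u ξ t) = θ at *
  generalize q2 ρ u w ξ t = y at *
  generalize q2 ρ u u ξ t = η at *
  generalize q1 ρ u w ξ t = r₀ at *
  have hM34 : M ^ 3 ≤ M ^ 4 := pow_le_pow_right₀ hM (by norm_num)
  have hM24 : M ^ 2 ≤ M ^ 4 := pow_le_pow_right₀ hM (by norm_num)
  have k1 : M ^ 3 * (1 + η ^ 2) * (θ * w ξ t ^ 2 + θ * r₀ ^ 2) ≤ M ^ 3 * (1 + η ^ 2) * (2 * M) := by
    gcongr; linarith
  have k2 : M ^ 3 * (θ * y ^ 2) ≤ M ^ 4 * (θ * y ^ 2) := by gcongr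
  have k3 : M ^ 2 * (θ * y ^ 2) ≤ M ^ 4 * (θ * y ^ 2) := by gcongr
  nlinarith

lemma wP (S : Sys T ρ u w) (B : Bd2 T ρ u w α M) {ξ t : ℝ} (h2 : T / 2 ≤ t) (h1 : t < T) :
    exp (u ξ t) ^ 2 * Hop ρ u w (fun x t => exp (2 * u x t) *
      (Ds ρ u x t * Ds ρ u x t)) ξ t ≤ - q2 ρ u u ξ t ^ 2 + 80 * M ^ 4 := by
  have h0 : 0 < t := by linarith [S.hT]
  have hM := B.b.m1
  refine (S.weight' B.b (S.sD S.su) 2 (by norm_num) (ξ := ξ) h2 h1).trans ?_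
  have n := S.N1u (ξ := ξ) h0 h1
  have r := realP (r := q1 ρ u w ξ t) hM
    (exp_pos (4 * w ξ t)).le (B.b.b4 ξ t h2 h1) (B.b.bp ξ t h2 h1) (unθ' B.b h2 h1 (B.br ξ t h2 h1))
  rw [← n] at r
  have e4 : exp (2 * u ξ t) = exp (u ξ t) ^ 2 := by rw [← Real.exp_nat_mul]; norm_num
  have e : exp (2 * u ξ t) * (2 * Ds ρ u ξ t * (exp (u ξ t) ^ 2 * Hop ρ u w (Ds ρ u) ξ t)
      - exp (u ξ t) ^ 2 * Ds ρ (Ds ρ u) ξ t ^ 2 + 56 * M ^ 2 * Ds ρ u ξ t ^ 2)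
      = 2 * q1 ρ u u ξ t * (exp (u ξ t) ^ 3 * Hop ρ u w (Ds ρ u) ξ t)
        - q2 ρ u u ξ t ^ 2
        + 56 * M ^ 2 * q1 ρ u u ξ t ^ 2 := by rw [e4]; simp only [q1, q2]; ring
  rw [e]
  have i1 : q1 ρ u u ξ t ^ 2 ≤ M ^ 2 := sq_le_sq' (by linarith [abs_le.1 (B.b.bp ξ t h2 h1)])
      (abs_le.1 (B.b.bp ξ t h2 h1)).2
  have i2 : M ^ 2 * q1 ρ u u ξ t ^ 2 ≤ M ^ 2 * M ^ 2 := by gcongr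
  nlinarith

lemma S5 (S : Sys T ρ u w) (B : Bd2 T ρ u w α M) :
    ∃ K, ∀ ξ t, T / 2 ≤ t → t < T → q2 ρ u u ξ t ^ 2 ≤ K ∧
      exp (-2 * α * u ξ t) * q2 ρ u w ξ t ^ 2 ≤ K := by
  set N := 1601 * M ^ 4 with hN
  have hM := B.b.m1
  have hM1 : 1 ≤ M ^ 4 := one_le_pow₀ hM
  have hN0 : 0 < N := by positivity
  set C := 1144 * M ^ 4 + N * (80 * M ^ 4 + 160 * M ^ 3) with hC
  have se : ∀ m : ℝ, Sm T (fun x t => exp (m * u x t)) := fun m => ((Sm.const T m).mul S.su).exp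
  have s1 := (se 4).mul ((S.sD (S.sD S.su)).mul (S.sD (S.sD S.su)))
  have s2 := (se (4 - 2 * α)).mul ((S.sD (S.sD S.sw)).mul (S.sD (S.sD S.sw)))
  have s3 := (se 2).mul ((S.sD S.su).mul (S.sD S.su))
  have s4 := (se (2 - 2 * α)).mul ((S.sD S.sw).mul (S.sD S.sw))
  have v1 : ∀ ξ t, exp (4 * u ξ t) * (Ds ρ (Ds ρ u) ξ t * Ds ρ (Ds ρ u) ξ t)
      = q2 ρ u u ξ t ^ 2 := fun ξ t => by
    have e4 : exp (4 * u ξ t) = exp (u ξ t) ^ 4 := by rw [← Real.exp_nat_mul]; norm_num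
    rw [e4]; simp only [q2]; ring
  have v2 : ∀ ξ t, exp ((4 - 2 * α) * u ξ t) * (Ds ρ (Ds ρ w) ξ t * Ds ρ (Ds ρ w) ξ t)
      = exp (-2 * α * u ξ t) * q2 ρ u w ξ t ^ 2 := fun ξ t => by
    rw [expm4]; simp only [q2]; ring
  have v3 : ∀ ξ t, exp (2 * u ξ t) * (Ds ρ u ξ t * Ds ρ u ξ t)
      = q1 ρ u u ξ t ^ 2 := fun ξ t => by
    have e4 : exp (2 * u ξ t) = exp (u ξ t) ^ 2 := by rw [← Real.exp_nat_mul]; norm_num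
    rw [e4]; simp only [q1]; ring
  have v4 : ∀ ξ t, exp ((2 - 2 * α) * u ξ t) * (Ds ρ w ξ t * Ds ρ w ξ t)
      = exp (-2 * α * u ξ t) * q1 ρ u w ξ t ^ 2 := fun ξ t => by
    rw [expm]; simp only [q1]; ring
  obtain ⟨K, hK, h⟩ := S.mp ((s1.add s2).add ((Sm.const T N).mul (s3.add s4)))
    (N * (M ^ 2 + M) + C)
    (fun ξ t h2 h1 hp _ => by
    have h0 : 0 < t := by linarith [S.hT]
    apply neg_of_E (E := u ξ t)
    rw [S.H_add (s1.add s2) ((Sm.const T N).mul (s3.add s4)) h0 h1, S.H_add s1 s2 h0 h1,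
      S.H_cmul (s3.add s4) N h0 h1, S.H_add s3 s4 h0 h1]
    have a1 := S.wU B (ξ := ξ) h2.le h1
    have a2 := S.wW B (ξ := ξ) h2.le h1
    have a3 := mul_le_mul_of_nonneg_left (S.wP B (ξ := ξ) h2.le h1) hN0.le
    have a4 := mul_le_mul_of_nonneg_left (S.wA B.b (ξ := ξ) h2.le h1) hN0.le
    simp only [v1, v2, v3, v4] at hp
    have hb := B.b.bw ξ t h2.le h1
    have hr := B.br ξ t h2.le h1
    have i1 : q1 ρ u u ξ t ^ 2 ≤ M ^ 2 := sq_le_sq' (by linarith [abs_le.1 (B.b.bp ξ t h2.le h1)])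
      (abs_le.1 (B.b.bp ξ t h2.le h1)).2
    have i2 : N * (q1 ρ u u ξ t ^ 2 + exp (-2 * α * u ξ t) * q1 ρ u w ξ t ^ 2)
      ≤ N * (M ^ 2 + M) := by gcongr
    have i3 : N * M ^ 2 * (exp (-2 * α * u ξ t) * q1 ρ u w ξ t ^ 2
      + exp (-2 * α * u ξ t) * w ξ t ^ 2) ≤ N * M ^ 2 * (M + M) := by gcongr
    have z0 : 0 ≤ exp (-2 * α * u ξ t) * q2 ρ u w ξ t ^ 2 := by positivity
    have z1 : 0 ≤ q2 ρ u u ξ t ^ 2 := by positivity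
    have z2 := mul_le_mul_of_nonneg_right hM1 z0
    have z3 := mul_le_mul_of_nonneg_right hM1 z1
    generalize Hop ρ u w _ ξ t = H1 at *
    generalize Hop ρ u w _ ξ t = H2 at *
    generalize Hop ρ u w _ ξ t = H3 at *
    generalize Hop ρ u w _ ξ t = H4 at *
    generalize exp (-2 * α * u ξ t) = θ at *
    generalize q2 ρ u w ξ t = y at *
    generalize q2 ρ u u ξ t = η at *
    have fin : 344 * M ^ 4 * (1 + η ^ 2 + θ * y ^ 2)
      + (1256 * M ^ 4 * (θ * y ^ 2) + 800 * M ^ 4 * (1 + η ^ 2))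
      + N * (-η ^ 2 + 80 * M ^ 4) + (N * (-(θ * y ^ 2)) + 80 * (N * M ^ 2 * (M + M))) < 0 := by
      rw [hN] at *; nlinarith
    linarith)
  refine ⟨K, fun ξ t h2 h1 => ?_⟩
  have := h ξ t h2 h1
  simp only [v1, v2, v3, v4] at this
  have h5 : 0 ≤ N * (q1 ρ u u ξ t ^ 2 + exp (-2 * α * u ξ t) * q1 ρ u w ξ t ^ 2) := by positivity
  have z0 : 0 ≤ exp (-2 * α * u ξ t) * q2 ρ u w ξ t ^ 2 := by positivity
  have z1 : 0 ≤ q2 ρ u u ξ t ^ 2 := by positivity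
  constructor <;> linarith

end Sys

namespace Sys
variable {T : ℝ} {ρ u w φ ψ : ℝ → ℝ → ℝ} {α M : ℝ}

/-- all bounds up to second order -/
structure Bd3 (T : ℝ) (ρ u w : ℝ → ℝ → ℝ) (α M : ℝ) : Prop where
  a0 : 0 < α
  a1 : α ≤ 1 / 2
  m1 : 1 ≤ M
  bu : ∀ ξ t, T / 2 ≤ t → t < T → u ξ t ≤ M
  b4 : ∀ ξ t, T / 2 ≤ t → t < T → exp (4 * w ξ t) ≤ M
  bp : ∀ ξ t, T / 2 ≤ t → t < T → |q1 ρ u u ξ t| ≤ M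
  bη : ∀ ξ t, T / 2 ≤ t → t < T → |q2 ρ u u ξ t| ≤ M
  br : ∀ ξ t, T / 2 ≤ t → t < T → |q1 ρ u w ξ t| ≤ M
  bY : ∀ ξ t, T / 2 ≤ t → t < T → |q2 ρ u w ξ t| ≤ M
  d4 : ∀ ξ t, T / 2 ≤ t → t < T → |exp (4 * w ξ t) - 1| ≤ M * exp (α * u ξ t)
  dr : ∀ ξ t, T / 2 ≤ t → t < T → |q1 ρ u w ξ t| ≤ M * exp (α * u ξ t)
  dY : ∀ ξ t, T / 2 ≤ t → t < T → |q2 ρ u w ξ t| ≤ M * exp (α * u ξ t)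

lemma toφ {α M x v : ℝ} (hM : 1 ≤ M) (h : exp (-2 * α * v) * x ^ 2 ≤ M) :
    |x| ≤ M * exp (α * v) := by
  apply abs_le_of_sq_le_sq _ (by positivity)
  have e : exp (α * v) ^ 2 * exp (-2 * α * v) = 1 := by
    rw [← Real.exp_nat_mul, ← exp_add]; ring_nf; simp
  calc x ^ 2 = exp (α * v) ^ 2 * (exp (-2 * α * v) * x ^ 2) := by rw [← mul_assoc, e, one_mul]
    _ ≤ exp (α * v) ^ 2 * M := by gcongr
    _ ≤ exp (α * v) ^ 2 * M ^ 2 := by gcongr; nlinarith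
    _ = _ := by ring

lemma S5' (S : Sys T ρ u w) : ∃ α M, Bd3 T ρ u w α M := by
  obtain ⟨α, M, B⟩ := S.S4'
  obtain ⟨K, h⟩ := S.S5 B
  have hM := B.b.m1
  set N := max M K with hN
  have hMN : M ≤ N := le_max_left _ _
  have hKN : K ≤ N := le_max_right _ _
  have hN1 : 1 ≤ N := hM.trans hMN
  have B' := B.b.mono hMN
  have hNN : N ≤ N ^ 2 := by nlinarith
  have up : ∀ {v : ℝ}, 0 ≤ v → N * v ≤ N ^ 2 * v := fun hv => mul_le_mul_of_nonneg_right hNN hv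
  refine ⟨α, N ^ 2, B.b.a0, B.b.a1, hN1.trans hNN, fun ξ t h2 h1 => (B'.bu ξ t h2 h1).trans hNN,
    fun ξ t h2 h1 => (B'.b4 ξ t h2 h1).trans hNN, fun ξ t h2 h1 => (B'.bp ξ t h2 h1).trans hNN,
    fun ξ t h2 h1 => ?_,
    fun ξ t h2 h1 => (unθ' B' h2 h1 ((B.br ξ t h2 h1).trans hMN)).trans hNN,
    fun ξ t h2 h1 => (unθ' B' h2 h1 ((h ξ t h2 h1).2.trans hKN)).trans hNN,
    fun ξ t h2 h1 => ?_,
    fun ξ t h2 h1 => (toφ hN1 ((B.br ξ t h2 h1).trans hMN)).trans (up (exp_pos _).le),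
    fun ξ t h2 h1 => (toφ hN1 ((h ξ t h2 h1).2.trans hKN)).trans (up (exp_pos _).le)⟩
  · refine le_trans (abs_le_of_sq_le_sq ?_ (by linarith)) hNN
    linarith [(h ξ t h2 h1).1]
  · refine (B'.d4 ξ t h2 h1).trans ?_
    have := toφ hN1 (B'.bw ξ t h2 h1)
    calc N * |w ξ t| ≤ N * (N * exp (α * u ξ t)) := by gcongr
      _ = _ := by ring

lemma real6 {A α p r η M F : ℝ} (a0 : 0 < α) (a1 : α ≤ 1 / 2) (hM : 1 ≤ M) (h40 : 0 ≤ A)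
    (h4 : A ≤ M)
    (hp : |p| ≤ M) (hF : 0 < F) (ha : |A - 1| ≤ M * F) (hr : |r| ≤ M * F)
    (hη : η = -((2 - α) * p ^ 2 + α) / 2) (hP : 1 + (10 * M ^ 4 + 1) * F < p ^ 2) :
    2 * p * (-2 * A * (4 * r - 2 * p) - (p ^ 2 + 2 * (p - r) ^ 2) * p) - 2 * η ^ 2
      + p ^ 2 * ((2 - α) * (-2 * A) - (2 - α) ^ 2 * p ^ 2) - 4 * (2 - α) * p ^ 2 * η
      - 2 * α * A + α ^ 2 * p ^ 2 < 0 := by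
  have hA : |A| ≤ M := by rwa [abs_of_nonneg h40]
  have e : 2 * p * (-2 * A * (4 * r - 2 * p) - (p ^ 2 + 2 * (p - r) ^ 2) * p) - 2 * η ^ 2
      + p ^ 2 * ((2 - α) * (-2 * A) - (2 - α) ^ 2 * p ^ 2) - 4 * (2 - α) * p ^ 2 * η
      - 2 * α * A + α ^ 2 * p ^ 2 =
      (p ^ 2 - 1) * (-(4 + 2 * α - α ^ 2 / 2) * p ^ 2 + 2 * α + α ^ 2 / 2)
      + (A - 1) * ((4 + 2 * α) * p ^ 2 - 2 * α) + (-16) * (A * p * r) + 8 * (p * p * p * r)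
      - 4 * p ^ 2 * r ^ 2 := by rw [hη]; ring
  have hM4 : 1 ≤ M ^ 4 := one_le_pow₀ hM
  have hp2 : p ^ 2 ≤ M ^ 2 := sq_le_sq' (by linarith [abs_le.1 hp]) (abs_le.1 hp).2
  have hP1 : 1 < p ^ 2 := by
    have : 0 < (10 * M ^ 4 + 1) * F := by positivity
    linarith
  have t0 : (p ^ 2 - 1) * (-(4 + 2 * α - α ^ 2 / 2) * p ^ 2 + 2 * α + α ^ 2 / 2)
      ≤ (p ^ 2 - 1) * (-3) := by
    apply mul_le_mul_of_nonneg_left _ (by linarith)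
    have c : 0 ≤ 4 + 2 * α - α ^ 2 / 2 := by nlinarith
    nlinarith [mul_nonneg c (sub_nonneg.2 hP1.le)]
  have c1 : |(4 + 2 * α) * p ^ 2 - 2 * α| ≤ 6 * M ^ 2 := by
    rw [abs_le]; constructor <;> nlinarith
  have t1 : |(A - 1) * ((4 + 2 * α) * p ^ 2 - 2 * α)| ≤ M * F * (6 * M ^ 2) := by
    rw [abs_mul]; gcongr
  have t2 : |(-16) * (A * p * r)| ≤ 16 * (M * M * (M * F)) := by
    rw [abs_mul, abs_mul, abs_mul]; norm_num; gcongr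
  have t3 : |8 * (p * p * p * r)| ≤ 8 * (M * M * M * (M * F)) := by
    rw [abs_mul, abs_mul, abs_mul, abs_mul, show |(8 : ℝ)| = 8 by norm_num]; gcongr
  have u1 := (le_abs_self _).trans t1
  have u2 := (le_abs_self _).trans t2
  have u3 := (le_abs_self _).trans t3
  have hM34 : M ^ 3 * F ≤ M ^ 4 * F := by
    gcongr; norm_num
  have z : 0 ≤ 4 * p ^ 2 * r ^ 2 := by positivity
  rw [e]
  nlinarith

lemma S6 (S : Sys T ρ u w) (B : Bd3 T ρ u w α M) :
    ∃ K, 0 ≤ K ∧ ∀ ξ t, T / 2 ≤ t → t < T → q1 ρ u u ξ t ^ 2 ≤ 1 + K * exp (α * u ξ t) := by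
  have hM := B.m1
  have se : ∀ m : ℝ, Sm T (fun x t => exp (m * u x t)) := fun m => ((Sm.const T m).mul S.su).exp
  have sq := (S.sD S.su).mul (S.sD S.su)
  have s1 := (se (2 - α)).mul sq
  have s2 := (Sm.const T (-1)).mul (se (-α))
  have ex : ∀ x : ℝ, exp ((2 - α) * x) = exp (-α * x) * exp x ^ 2 := fun x => by
    rw [← Real.exp_nat_mul, ← exp_add]; ring_nf
  have ex1 : ∀ x : ℝ, exp (α * x) * exp (-α * x) = 1 := fun x => by
    rw [← exp_add]; ring_nf; simp
  have val : ∀ ξ t, exp ((2 - α) * u ξ t) * (Ds ρ u ξ t * Ds ρ u ξ t) + -1 * exp (-α * u ξ t)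
      = exp (-α * u ξ t) * (q1 ρ u u ξ t ^ 2 - 1) := fun ξ t => by
    rw [ex]; simp only [q1]; ring
  have back : ∀ ξ t, q1 ρ u u ξ t ^ 2 - 1 = exp (α * u ξ t) *
    (exp (-α * u ξ t) * (q1 ρ u u ξ t ^ 2 - 1)) := fun ξ t => by
      rw [← mul_assoc, ex1, one_mul]
  obtain ⟨K, hK, h⟩ := S.mp (s1.add s2) (10 * M ^ 4 + 1) (fun ξ t h2 h1 hp hd => by
    have h0 : 0 < t := by linarith [S.hT]
    simp only [val] at hp
    rw [S.D_add s1 s2 h0 h1, S.D_mul (se _) sq h0 h1, S.D_cmul (se _) _ h0 h1,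
      S.D_exp ((Sm.const T _).mul S.su) h0 h1, S.D_exp ((Sm.const T _).mul S.su) h0 h1,
      S.D_cmul S.su _ h0 h1, S.D_cmul S.su _ h0 h1, S.D_mul (S.sD S.su) (S.sD S.su) h0 h1, ex] at hd
    have hE := exp_pos (u ξ t)
    have hF := exp_pos (α * u ξ t)
    have hG := exp_pos (-α * u ξ t)
    have hP : 1 + (10 * M ^ 4 + 1) * exp (α * u ξ t) < q1 ρ u u ξ t ^ 2 := by
      have := back ξ t
      have := mul_lt_mul_of_pos_left hp hF
      linarith
    have hne : Ds ρ u ξ t ≠ 0 := by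
      intro hz
      have : q1 ρ u u ξ t = 0 := by rw [q1, hz, mul_zero]
      rw [this] at hP
      have : 0 < (10 * M ^ 4 + 1) * exp (α * u ξ t) := by positivity
      linarith
    have hη : q2 ρ u u ξ t = -((2 - α) * q1 ρ u u ξ t ^ 2 + α) / 2 := by
      have : (exp (-α * u ξ t) * Ds ρ u ξ t) * (2 * q2 ρ u u ξ t + (2 - α) * q1 ρ u u ξ t ^ 2 + α)
          = 0 := by rw [← hd]; simp only [q1, q2]; ring
      have := (mul_eq_zero.1 this).resolve_left (mul_ne_zero hG.ne' hne)
      linarith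
    apply neg_of_E (E := u ξ t)
    rw [S.H_add s1 s2 h0 h1, S.H_mul (se _) sq h0 h1, S.H_cmul (se _) _ h0 h1,
      S.H_exp ((Sm.const T _).mul S.su) h0 h1, S.H_exp ((Sm.const T _).mul S.su) h0 h1,
      S.D_exp ((Sm.const T _).mul S.su) h0 h1,
      S.D_cmul S.su _ h0 h1, S.D_cmul S.su _ h0 h1, S.H_cmul S.su _ h0 h1, S.H_cmul S.su _ h0 h1,
      S.D_mul (S.sD S.su) (S.sD S.su) h0 h1, S.H_mul (S.sD S.su) (S.sD S.su) h0 h1, ex]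
    have n0 := S.N0u (ξ := ξ) h0 h1
    have n1 := S.N1u (ξ := ξ) h0 h1
    have key := real6 B.a0 B.a1 hM (exp_pos (4 * w ξ t)).le (B.b4 ξ t h2.le h1) (B.bp ξ t h2.le h1)
      hF (B.d4 ξ t h2.le h1) (B.dr ξ t h2.le h1) hη hP
    rw [← n1] at key
    have key2 := mul_neg_of_pos_of_neg hG key
    refine lt_of_eq_of_lt ?_ key2
    have n0' : -2 * exp (4 * w ξ t) = exp (u ξ t) ^ 2 * Hop ρ u w u ξ t := n0.symm
    have n0'' : exp (4 * w ξ t) = - (exp (u ξ t) ^ 2 * Hop ρ u w u ξ t) / 2 := by linarith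
    rw [n0'']
    simp only [q1, q2]
    ring)
  have hK0 : 0 ≤ K := by have : 0 ≤ M ^ 4 := by positivity
                         linarith
  refine ⟨K, hK0, fun ξ t h2 h1 => ?_⟩
  have h3 := h ξ t h2 h1
  simp only [val] at h3
  have := mul_le_mul_of_nonneg_left h3 (exp_pos (α * u ξ t)).le
  rw [← back] at this
  linarith

end Sys

namespace Sys
variable {T : ℝ} {ρ u w φ ψ : ℝ → ℝ → ℝ} {α M : ℝ}

lemma expsq {α C x : ℝ} (a0 : 0 < α) (hx : x ≤ C) :
    exp (α * x) * (C - x) ^ 2 ≤ 2 / α ^ 2 * exp (α * C) := by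
  have h := Real.quadratic_le_exp_of_nonneg (x := α * (C - x)) (mul_nonneg a0.le (by linarith))
  have h2 : 0 ≤ α * (C - x) := mul_nonneg a0.le (by linarith)
  have e : exp (α * C) = exp (α * x) * exp (α * (C - x)) := by rw [← exp_add]; ring_nf
  rw [e]
  have : (C - x) ^ 2 ≤ 2 / α ^ 2 * exp (α * (C - x)) := by
    rw [div_mul_eq_mul_div, le_div_iff₀ (by positivity)]
    nlinarith
  calc _ ≤ exp (α * x) * (2 / α ^ 2 * exp (α * (C - x))) := by gcongr
    _ = _ := by ring

lemma real7 {A p r η y M F K : ℝ} (hM : 1 ≤ M) (h40 : 0 ≤ A) (h4 : A ≤ M)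
    (hp : |p| ≤ M) (hη : |η| ≤ M) (hr : |r| ≤ M) (hF : 0 < F)
    (ha : |A - 1| ≤ M * F) (dr : |r| ≤ M * F) (hy : |y| ≤ M) (dy : |y| ≤ M * F) (hK : 0 ≤ K)
    (hP : p ^ 2 ≤ 1 + K * F) (hX : 0 ≤ η + p ^ 2) :
    (-2 * A * ((4 * r - 2 * p) ^ 2 + (4 * y - 2 * η))
      - 2 * (p ^ 2 + 2 * (p - r) ^ 2) * η
      - (2 * p * η + 4 * (p - r) * (η - y)) * p)
      + 2 * p * (-2 * A * (4 * r - 2 * p) - (p ^ 2 + 2 * (p - r) ^ 2) * p) - 2 * η ^ 2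
      + 4 * (η + p ^ 2) * (p ^ 2 - A) ≤
      -2 * (η + p ^ 2) ^ 2 + (100 * M ^ 4 + 4 * M ^ 2 * K) * F := by
  have hA : |A| ≤ M := by rwa [abs_of_nonneg h40]
  have hp2 : p ^ 2 ≤ M ^ 2 := sq_le_sq' (by linarith [abs_le.1 hp]) (abs_le.1 hp).2
  have c1 : |-4 * p ^ 2| ≤ 4 * M ^ 2 := by
    rw [abs_le]; constructor <;> nlinarith
  have c2 : |A * (16 * p - 32 * r) + 12 * p * η - 4 * r * η - 4 * p * y + 8 * (p * p ^ 2)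
      - 4 * (r * p ^ 2)| ≤ 80 * M ^ 3 := by
    have d1 : |A * (16 * p - 32 * r)| ≤ M * (48 * M) := by
      rw [abs_mul]; gcongr
      rw [abs_le]; constructor <;> linarith [abs_le.1 hp, abs_le.1 hr]
    have d2 : |p * η| ≤ M * M := by rw [abs_mul]; gcongr
    have d3 : |r * η| ≤ M * M := by rw [abs_mul]; gcongr
    have d4 : |p * y| ≤ M * M := by rw [abs_mul]; gcongr
    have d5 : |p * p ^ 2| ≤ M * M ^ 2 := by rw [abs_mul, abs_of_nonneg (sq_nonneg p)]; gcongr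
    have d6 : |r * p ^ 2| ≤ M * M ^ 2 := by rw [abs_mul, abs_of_nonneg (sq_nonneg p)]; gcongr
    have m23 : M * M ≤ M ^ 3 := by nlinarith
    rw [abs_le] at d1 d2 d3 d4 d5 d6 ⊢
    constructor <;> nlinarith
  have c3 : |-8 * A + 4 * p ^ 2| ≤ 8 * M ^ 2 := by
    rw [abs_le]; constructor <;> nlinarith
  have t1 : |(A - 1) * (-4 * p ^ 2)| ≤ M * F * (4 * M ^ 2) := by rw [abs_mul]; gcongr
  have t2 : |r * (A * (16 * p - 32 * r) + 12 * p * η - 4 * r * η - 4 * p * y + 8 * (p * p ^ 2)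
      - 4 * (r * p ^ 2))| ≤ M * F * (80 * M ^ 3) := by rw [abs_mul]; gcongr
  have t3 : |y * (-8 * A + 4 * p ^ 2)| ≤ M * F * (8 * M ^ 2) := by rw [abs_mul]; gcongr
  have u1 := (le_abs_self _).trans t1
  have u2 := (le_abs_self _).trans t2
  have u3 := (le_abs_self _).trans t3
  have hM34 : M ^ 3 * F ≤ M ^ 4 * F := by gcongr; norm_num
  have v1 : p ^ 2 * (p ^ 2 - 1) ≤ M ^ 2 * (K * F) := by
    have : 0 ≤ K * F := by positivity
    calc _ ≤ p ^ 2 * (K * F) := by gcongr; linarith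
      _ ≤ _ := by gcongr
  have v2 : 0 ≤ p ^ 2 * (η + p ^ 2) := by positivity
  have e : (-2 * A * ((4 * r - 2 * p) ^ 2 + (4 * y - 2 * η))
      - 2 * (p ^ 2 + 2 * (p - r) ^ 2) * η
      - (2 * p * η + 4 * (p - r) * (η - y)) * p)
      + 2 * p * (-2 * A * (4 * r - 2 * p) - (p ^ 2 + 2 * (p - r) ^ 2) * p) - 2 * η ^ 2
      + 4 * (η + p ^ 2) * (p ^ 2 - A) =
      -2 * (η + p ^ 2) ^ 2 - 4 * (p ^ 2 * (η + p ^ 2)) + 4 * (p ^ 2 * (p ^ 2 - 1))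
      + (A - 1) * (-4 * p ^ 2)
      + r * (A * (16 * p - 32 * r) + 12 * p * η - 4 * r * η - 4 * p * y + 8 * (p * p ^ 2)
      - 4 * (r * p ^ 2)) + y * (-8 * A + 4 * p ^ 2) := by ring
  rw [e]
  have v3 : 0 ≤ M ^ 4 * F := by positivity
  linarith

lemma S7 (S : Sys T ρ u w) (B : Bd3 T ρ u w α M) :
    ∃ K, 0 ≤ K ∧ ∀ ξ t, T / 2 ≤ t → t < T →
      (q2 ρ u u ξ t + q1 ρ u u ξ t ^ 2) * (M + 1 - u ξ t) ≤ K := by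
  have hM := B.m1
  obtain ⟨J, hJ, h6⟩ := S.S6 B
  set C := 100 * M ^ 4 + 4 * M ^ 2 * J with hC
  set L := 2 / α ^ 2 * exp (α * (M + 1)) with hL
  have hC0 : 0 ≤ C := by positivity
  have hL0 : 0 ≤ L := by positivity
  have s2 : Sm T (fun x t => exp (2 * u x t)) := ((Sm.const T 2).mul S.su).exp
  have sz := (S.sD (S.sD S.su)).add ((S.sD S.su).mul (S.sD S.su))
  have sX := s2.mul sz
  have sL := (Sm.const T (M + 1)).add ((Sm.const T (-1)).mul S.su)
  have e2 : ∀ x : ℝ, exp (2 * x) = exp x ^ 2 := fun x => by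
    rw [← Real.exp_nat_mul]; norm_num
  have valX : ∀ ξ t, exp (2 * u ξ t) * (Ds ρ (Ds ρ u) ξ t + Ds ρ u ξ t * Ds ρ u ξ t)
      = q2 ρ u u ξ t + q1 ρ u u ξ t ^ 2 := fun ξ t => by
    rw [e2]; simp only [q1, q2]; ring
  obtain ⟨K, hK, h⟩ := S.mp (sX.mul sL) (M + C * L + 1) (fun ξ t h2 h1 hp hd => by
    have h0 : 0 < t := by linarith [S.hT]
    have hE := exp_pos (u ξ t)
    have hF := exp_pos (α * u ξ t)
    simp only [valX] at hp
    rw [S.D_mul sX sL h0 h1, S.D_add (Sm.const T (M + 1)) ((Sm.const T (-1)).mul S.su) h0 h1,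
      S.D_const, S.D_cmul S.su _ h0 h1, valX] at hd
    have hDX : Ds ρ (fun x t => exp (2 * u x t) * (Ds ρ (Ds ρ u) x t + Ds ρ u x t * Ds ρ u x t)) ξ t
      = _ := S.D_mul s2 sz h0 h1
    rw [S.D_exp ((Sm.const T _).mul S.su) h0 h1, S.D_cmul S.su _ h0 h1] at hDX
    have hHX : Hop ρ u w (fun x t => exp (2 * u x t) * (Ds ρ (Ds ρ u) x t + Ds ρ u x t * Ds ρ u x t))
      ξ t = _ := S.H_mul s2 sz h0 h1
    rw [S.D_exp ((Sm.const T _).mul S.su) h0 h1, S.D_cmul S.su _ h0 h1,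
      S.H_exp ((Sm.const T _).mul S.su) h0 h1, S.D_cmul S.su _ h0 h1, S.H_cmul S.su _ h0 h1,
      S.H_add (S.sD (S.sD S.su)) ((S.sD S.su).mul (S.sD S.su)) h0 h1,
      S.H_mul (S.sD S.su) (S.sD S.su) h0 h1] at hHX
    have n0 := S.N0u (ξ := ξ) h0 h1
    have n1 := S.N1u (ξ := ξ) h0 h1
    have n2 := S.N2u (ξ := ξ) h0 h1
    have hΛ : 1 ≤ M + 1 + -1 * u ξ t := by linarith [B.bu ξ t h2.le h1]
    have hLL := expsq B.a0 (show u ξ t ≤ M + 1 by linarith)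
    have hX : 0 < q2 ρ u u ξ t + q1 ρ u u ξ t ^ 2 := by
      by_contra! hx
      have : 0 ≤ C * L := by positivity
      nlinarith
    have key := real7 hM (exp_pos (4 * w ξ t)).le (B.b4 ξ t h2.le h1) (B.bp ξ t h2.le h1)
      (B.bη ξ t h2.le h1) (B.br ξ t h2.le h1) hF (B.d4 ξ t h2.le h1) (B.dr ξ t h2.le h1)
      (B.bY ξ t h2.le h1) (B.dY ξ t h2.le h1) hJ (h6 ξ t h2.le h1) hX.le
    rw [← n1, ← n2] at key
    apply neg_of_E (E := u ξ t)
    rw [S.H_mul sX sL h0 h1, S.H_add (Sm.const T (M + 1)) ((Sm.const T (-1)).mul S.su) h0 h1,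
      S.H_const, S.H_cmul S.su _ h0 h1, S.D_add (Sm.const T (M + 1)) ((Sm.const T (-1)).mul S.su) h0 h1,
      S.D_const, S.D_cmul S.su _ h0 h1, valX]
    have EHX : exp (u ξ t) ^ 2 * Hop ρ u w (fun x t => exp (2 * u x t) *
        (Ds ρ (Ds ρ u) x t + Ds ρ u x t * Ds ρ u x t)) ξ t =
        exp (u ξ t) ^ 4 * Hop ρ u w (Ds ρ (Ds ρ u)) ξ t
        + 2 * q1 ρ u u ξ t * (exp (u ξ t) ^ 3 * Hop ρ u w (Ds ρ u) ξ t) - 2 * q2 ρ u u ξ t ^ 2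
        + 4 * (q2 ρ u u ξ t + q1 ρ u u ξ t ^ 2) * (q1 ρ u u ξ t ^ 2 - exp (4 * w ξ t))
        - 4 * q1 ρ u u ξ t * (exp (u ξ t) * Ds ρ (fun x t => exp (2 * u x t) *
          (Ds ρ (Ds ρ u) x t + Ds ρ u x t * Ds ρ u x t)) ξ t) := by
      rw [hHX, hDX]
      have n0'' : exp (4 * w ξ t) = - (exp (u ξ t) ^ 2 * Hop ρ u w u ξ t) / 2 := by linarith
      rw [n0'']
      simp only [q1, q2, e2]
      ring
    have n0' := congrArg (fun z => (q2 ρ u u ξ t + q1 ρ u u ξ t ^ 2) * z) n0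
    have hcr : (M + 1 + -1 * u ξ t) * (exp (u ξ t) * Ds ρ (fun x t => exp (2 * u x t) *
          (Ds ρ (Ds ρ u) x t + Ds ρ u x t * Ds ρ u x t)) ξ t)
        = (q2 ρ u u ξ t + q1 ρ u u ξ t ^ 2) * q1 ρ u u ξ t := by
      have := congrArg (fun z => exp (u ξ t) * z) hd
      simp only [q1] at this ⊢
      linarith
    have eD : q1 ρ u u ξ t = exp (u ξ t) * Ds ρ u ξ t := rfl
    have hA4 := B.b4 ξ t h2.le h1
    have hA0 := exp_pos (4 * w ξ t)
    generalize Ds ρ (fun x t => exp (2 * u x t) *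
          (Ds ρ (Ds ρ u) x t + Ds ρ u x t * Ds ρ u x t)) ξ t = DX at *
    generalize Hop ρ u w (fun x t => exp (2 * u x t) *
          (Ds ρ (Ds ρ u) x t + Ds ρ u x t * Ds ρ u x t)) ξ t = HX at *
    generalize hΛe : M + 1 + -1 * u ξ t = Λ at *
    have hLL' : exp (α * u ξ t) * Λ ^ 2 ≤ L := by rw [← hΛe]; convert hLL using 2; ring
    generalize hXe : q2 ρ u u ξ t + q1 ρ u u ξ t ^ 2 = X at *
    generalize q1 ρ u u ξ t = p at *
    generalize exp (4 * w ξ t) = A at *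
    have tgt : exp (u ξ t) ^ 2 * (X * (0 + -1 * Hop ρ u w u ξ t) + Λ * HX
        - 2 * DX * (0 + -1 * Ds ρ u ξ t)) = Λ * (exp (u ξ t) ^ 2 * HX) + 2 * A * X
          + 2 * p * (exp (u ξ t) * DX) := by
      rw [eD]; linear_combination (-X) * n0
    rw [tgt]
    have hΛ0 : 0 < Λ := by linarith
    have fin : Λ * (Λ * (exp (u ξ t) ^ 2 * HX) + 2 * A * X + 2 * p * (exp (u ξ t) * DX)) < 0 := by
      have i1 : Λ * (Λ * (exp (u ξ t) ^ 2 * HX) + 2 * A * X + 2 * p * (exp (u ξ t) * DX))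
        ≤ Λ ^ 2 * (-2 * X ^ 2 + C * exp (α * u ξ t)) - 4 * p * Λ * (X * p) + 2 * A * X * Λ
          + 2 * p * (X * p) := by
        have := mul_le_mul_of_nonneg_left key (sq_nonneg Λ)
        rw [← hcr]
        have e := congrArg (fun z => Λ ^ 2 * z) EHX
        linarith
      have i2 : 0 ≤ (p ^ 2 * X) * (Λ - 1) := mul_nonneg (by positivity) (by linarith)
      have i3 : A * (X * Λ) ≤ M * (X * Λ) := by gcongr
      have i4 := mul_le_mul_of_nonneg_left hLL' hC0
      have i5 : 0 ≤ p ^ 2 * X := by positivity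
      have i6 : 0 ≤ C * L := by positivity
      have i7 : (X * Λ) * (X * Λ - M) > 1 * (C * L) := by
        apply mul_lt_mul' <;> linarith
      linarith
    by_contra! hh
    have := mul_nonneg hΛ0.le hh
    linarith)
  have : 0 ≤ C * L := by positivity
  refine ⟨K, by linarith, fun ξ t h2 h1 => ?_⟩
  have h3 := h ξ t h2 h1
  simp only [valX] at h3
  rw [show M + 1 - u ξ t = M + 1 + -1 * u ξ t by ring]
  exact h3

end Sys

namespace Sys
variable {T α M : ℝ} {ρ u w φ ψ : ℝ → ℝ → ℝ}

lemma S8 (S : Sys T ρ u w) (B : Bd3 T ρ u w α M) :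
    ∃ D : ℝ, 0 ≤ D ∧ ∀ ξ t, T / 2 ≤ t → t < T → u ξ t ≤ -D → T - t ≤ exp (u ξ t) ^ 2 := by
  obtain ⟨K, K0, hK⟩ := S.S7 B
  have hα := B.a0
  have hM := B.m1
  have hlog : 0 ≤ Real.log (4 * M) := Real.log_nonneg (by linarith)
  have hq : 0 ≤ Real.log (4 * M) / α := by positivity
  refine ⟨Real.log (4 * M) / α + 2 * K + 2, by linarith, ?_⟩
  set D := Real.log (4 * M) / α + 2 * K + 2 with hD
  -- the pointwise facts in the deep region
  have deep : ∀ ξ t, T / 2 ≤ t → t < T → u ξ t ≤ -D →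
      q2 ρ u u ξ t + q1 ρ u u ξ t ^ 2 ≤ 1 / 2 ∧ 3 / 4 ≤ exp (4 * w ξ t) := by
    intro ξ t h0 h1 hu
    constructor
    · have h := hK ξ t h0 h1
      by_contra! hc
      have hL : 2 * K + 2 ≤ M + 1 - u ξ t := by linarith
      nlinarith
    · have h := (abs_le.mp (B.d4 ξ t h0 h1)).1
      have h2 : exp (α * u ξ t) ≤ 1 / (4 * M) := by
        have h3 : α * u ξ t ≤ -Real.log (4 * M) := by
          have : u ξ t ≤ -(Real.log (4 * M) / α) := by linarith
          calc α * u ξ t ≤ α * -(Real.log (4 * M) / α) := by gcongr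
            _ = -Real.log (4 * M) := by field_simp
        calc exp (α * u ξ t) ≤ exp (-Real.log (4 * M)) := exp_le_exp.mpr h3
          _ = 1 / (4 * M) := by rw [exp_neg, exp_log (by linarith)]; simp
      have h4 : M * exp (α * u ξ t) ≤ 1 / 4 := by
        calc M * exp (α * u ξ t) ≤ M * (1 / (4 * M)) := by gcongr
          _ = 1 / 4 := by field_simp
      linarith
  have hT := S.hT
  have hpi : (0 : ℝ) < 2 * π := by positivity
  intro ξ1 t1 ht1 ht1T hu1
  by_contra! hlt
  obtain ⟨t2, h12, h2T⟩ : ∃ t2, t1 + exp (u ξ1 t1) ^ 2 < t2 ∧ t2 < T :=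
    exists_between (by linarith)
  have hs0 : 0 < exp (u ξ1 t1) ^ 2 := by positivity
  have per : ∀ ξ t, ∃ y ∈ Icc 0 (2 * π), u ξ t = u y t := by
    intro ξ t
    have hp : Function.Periodic (fun x => u x t) (2 * π) := fun x => S.su.2 x t
    obtain ⟨y, hy, e⟩ := hp.exists_mem_Ico₀ hpi ξ
    exact ⟨y, ⟨hy.1, hy.2.le⟩, e⟩
  have hcomp : IsCompact (Icc (0 : ℝ) (2 * π) ×ˢ Icc t1 t2) := isCompact_Icc.prod isCompact_Icc
  have hco : ContinuousOn (fun x : ℝ × ℝ => exp (u x.1 x.2) ^ 2 + x.2)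
      (Icc (0 : ℝ) (2 * π) ×ˢ Icc t1 t2) := by
    rintro ⟨a, b⟩ ⟨_, hb⟩
    simp only at hb
    have hc : ContinuousAt (fun x : ℝ × ℝ => u x.1 x.2) (a, b) :=
      (S.su.1 a b (by linarith [hb.1]) (by linarith [hb.2])).continuousAt
    exact (((hc.rexp).pow 2).add continuousAt_snd).continuousWithinAt
  obtain ⟨y1, hy1, e1⟩ := per ξ1 t1
  obtain ⟨⟨a, b⟩, ⟨_, hb⟩, hmin⟩ :=
    hcomp.exists_isMinOn ⟨(y1, t1), hy1, le_rfl, by linarith⟩ hco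
  have hmin' : ∀ x s, t1 ≤ s → s ≤ t2 → exp (u a b) ^ 2 + b ≤ exp (u x s) ^ 2 + s := by
    intro x s hs hs1
    obtain ⟨y, hy, e⟩ := per x s
    rw [e]
    exact hmin (show (y, s) ∈ _ from ⟨hy, hs, hs1⟩)
  simp only at hb
  have hb0 : 0 < b := by linarith [hb.1]
  have hbT : b < T := by linarith [hb.2]
  have hm1 := hmin' ξ1 t1 le_rfl (by linarith)
  have hsab : 0 < exp (u a b) ^ 2 := by positivity
  have hbne : b < t2 := by
    rcases hb.2.lt_or_eq with h | h
    · exact h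
    · exfalso; linarith
  have hub : u a b ≤ u ξ1 t1 := by
    have : exp (u a b) ^ 2 ≤ exp (u ξ1 t1) ^ 2 := by linarith [hb.1]
    exact exp_le_exp.mp ((sq_le_sq₀ (exp_pos _).le (exp_pos _).le).mp this)
  obtain ⟨hX, hA⟩ := deep a b (by linarith [hb.1]) hbT (by linarith)
  have hloc : IsLocalMin (fun x => u x b) a := Filter.Eventually.of_forall fun x => by
    have : exp (u a b) ^ 2 ≤ exp (u x b) ^ 2 := by linarith [hmin' x b hb.1 hb.2]
    exact exp_le_exp.mp ((sq_le_sq₀ (exp_pos _).le (exp_pos _).le).mp this)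
  have hd1 : pd1 u a b = 0 := hloc.deriv_eq_zero
  have hD1 : Ds ρ u a b = 0 := by rw [Ds, hd1, zero_div]
  have hN := S.N0u (ξ := a) hb0 hbT
  have hut : exp (u a b) ^ 2 * pdt u a b ≤ -1 := by
    rw [Hop, hD1] at hN
    rw [q2, q1, hD1] at hX
    nlinarith
  have hder : HasDerivAt (fun s => exp (u a s) ^ 2 + s)
      (2 * (exp (u a b) ^ 2 * pdt u a b) + 1) b := by
    refine ((((S.dt S.su (ξ := a) hb0 hbT).exp).pow 2).add (hasDerivAt_id b)).congr_deriv ?_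
    simp
    ring
  have hsub : Ioi b ⊆ {b}ᶜ := fun x (hx : b < x) => ne_of_gt hx
  have hsl := (hasDerivAt_iff_tendsto_slope.mp hder).mono_left (nhdsWithin_mono b hsub)
  have : 0 ≤ 2 * (exp (u a b) ^ 2 * pdt u a b) + 1 := by
    refine ge_of_tendsto hsl ?_
    have hm : Ioo b t2 ∈ 𝓝[>] b := Ioo_mem_nhdsGT hbne
    filter_upwards [hm] with s hs
    rw [slope_def_field]
    apply div_nonneg
    · linarith [hmin' a s (by linarith [hs.1, hb.1]) hs.2.le]
    · linarith [hs.1]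
  linarith

end Sys

namespace Sys
variable {T α M : ℝ} {ρ u w φ ψ : ℝ → ℝ → ℝ}

lemma taulog {τ v : ℝ} (h0 : 0 < τ) (h1 : τ < 1) (hv : v ≤ 0) (h : τ ≤ exp v ^ 2) :
    τ * |Real.log τ| ≤ exp v ^ 2 * (1 - 2 * v) := by
  have hE : 0 < exp v ^ 2 := by positivity
  have e : Real.log (exp v ^ 2 / τ) = 2 * v - Real.log τ := by
    rw [Real.log_div hE.ne' h0.ne', Real.log_pow, Real.log_exp]; norm_num
  have h2 := Real.log_le_sub_one_of_pos (div_pos hE h0)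
  rw [e] at h2
  have h3 : τ * (2 * v - Real.log τ) ≤ exp v ^ 2 - τ := by
    calc τ * (2 * v - Real.log τ) ≤ τ * (exp v ^ 2 / τ - 1) := by gcongr
      _ = exp v ^ 2 - τ := by field_simp
  rw [abs_of_neg (Real.log_neg h0 h1)]
  nlinarith

lemma S9 (S : Sys T ρ u w) : ∃ D C : ℝ, 0 ≤ D ∧ 0 ≤ C ∧ ∀ ξ t, T / 2 ≤ t → t < T → T - t < 1 →
    u ξ t ≤ -D → 0 ≤ Ds ρ (Ds ρ u) ξ t + Ds ρ u ξ t ^ 2 →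
    (T - t) * |Ds ρ (Ds ρ u) ξ t + Ds ρ u ξ t ^ 2| * |Real.log (T - t)| ≤ C ∧
    (T - t) * |Ds ρ (Ds ρ u) ξ t - Ds ρ (Ds ρ w) ξ t + (Ds ρ u ξ t - Ds ρ w ξ t) ^ 2|
      * |Real.log (T - t)| ≤ C := by
  obtain ⟨α, M, B⟩ := S.S5'
  obtain ⟨K, K0, hK⟩ := S.S7 B
  obtain ⟨D, D0, hD⟩ := S.S8 B
  have hα := B.a0
  have hM := B.m1
  set Q := 2 / α ^ 2 * exp (α * (M + 1)) with hQ
  have hQ0 : 0 ≤ Q := by positivity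
  refine ⟨D, 2 * (K + 4 * M ^ 2 * Q), D0, by positivity, ?_⟩
  intro ξ t h0 h1 hτ hu hX
  have hu0 : u ξ t ≤ 0 := by linarith
  have hE : 0 < exp (u ξ t) ^ 2 := by positivity
  set L := M + 1 - u ξ t with hL
  have hL1 : 1 ≤ L := by linarith
  have hlog := taulog (by linarith) hτ hu0 (hD ξ t h0 h1 hu)
  have key : ∀ W : ℝ, exp (u ξ t) ^ 2 * |W| * L ≤ K + 4 * M ^ 2 * Q →
      (T - t) * |W| * |Real.log (T - t)| ≤ 2 * (K + 4 * M ^ 2 * Q) := by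
    intro W hW
    have hl2 : (T - t) * |Real.log (T - t)| ≤ exp (u ξ t) ^ 2 * (2 * L) := by
      refine hlog.trans ?_
      gcongr
      linarith
    calc (T - t) * |W| * |Real.log (T - t)| = (T - t) * |Real.log (T - t)| * |W| := by ring
      _ ≤ exp (u ξ t) ^ 2 * (2 * L) * |W| := by gcongr
      _ = 2 * (exp (u ξ t) ^ 2 * |W| * L) := by ring
      _ ≤ _ := by linarith
  have hXK := hK ξ t h0 h1
  have hMQ : 0 ≤ 4 * M ^ 2 * Q := by positivity
  have eX : exp (u ξ t) ^ 2 * (Ds ρ (Ds ρ u) ξ t + Ds ρ u ξ t ^ 2)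
      = q2 ρ u u ξ t + q1 ρ u u ξ t ^ 2 := by rw [q1, q2]; ring
  have hX' : 0 ≤ q2 ρ u u ξ t + q1 ρ u u ξ t ^ 2 := by rw [← eX]; positivity
  constructor
  · apply key
    rw [abs_of_nonneg hX, eX]
    linarith
  · apply key
    have eZ : exp (u ξ t) ^ 2 *
        |Ds ρ (Ds ρ u) ξ t - Ds ρ (Ds ρ w) ξ t + (Ds ρ u ξ t - Ds ρ w ξ t) ^ 2|
        = |q2 ρ u u ξ t + q1 ρ u u ξ t ^ 2 - q2 ρ u w ξ t
            - (2 * q1 ρ u u ξ t - q1 ρ u w ξ t) * q1 ρ u w ξ t| := by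
      rw [← abs_of_pos hE, ← abs_mul, q1, q1, q2, q2]
      congr 1; ring
    rw [eZ]
    have hp := B.bp ξ t h0 h1
    have hr := B.br ξ t h0 h1
    have hdr := B.dr ξ t h0 h1
    have hdY := B.dY ξ t h0 h1
    have hes : exp (α * u ξ t) * L ^ 2 ≤ Q := expsq hα (by linarith)
    have he : exp (α * u ξ t) * L ≤ Q := by
      refine le_trans ?_ hes
      gcongr
      nlinarith
    have h3 : |2 * q1 ρ u u ξ t - q1 ρ u w ξ t| ≤ 3 * M := by
      rw [abs_le] at *
      constructor <;> linarith [hp.1, hp.2, hr.1, hr.2]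
    have h4 : |(2 * q1 ρ u u ξ t - q1 ρ u w ξ t) * q1 ρ u w ξ t|
        ≤ 3 * M * (M * exp (α * u ξ t)) := by
      rw [abs_mul]; gcongr
    have h5 : |q2 ρ u u ξ t + q1 ρ u u ξ t ^ 2 - q2 ρ u w ξ t
            - (2 * q1 ρ u u ξ t - q1 ρ u w ξ t) * q1 ρ u w ξ t|
        ≤ (q2 ρ u u ξ t + q1 ρ u u ξ t ^ 2) + 4 * M ^ 2 * exp (α * u ξ t) := by
      have h6 : M * exp (α * u ξ t) ≤ M ^ 2 * exp (α * u ξ t) := by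
        gcongr; nlinarith
      have a1 := abs_le.mp h4
      have a2 := abs_le.mp hdY
      have := exp_pos (α * u ξ t)
      rw [abs_le]
      have a3 : 3 * M * (M * exp (α * u ξ t)) = 3 * (M ^ 2 * exp (α * u ξ t)) := by ring
      have a4 : 0 ≤ M ^ 2 * exp (α * u ξ t) := by positivity
      rw [a3] at a1
      constructor
      · linarith [a1.1, a1.2, a2.1, a2.2]
      · linarith [a1.1, a1.2, a2.1, a2.2]
    calc _ ≤ ((q2 ρ u u ξ t + q1 ρ u u ξ t ^ 2) + 4 * M ^ 2 * exp (α * u ξ t)) * L := by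
          gcongr
      _ = (q2 ρ u u ξ t + q1 ρ u u ξ t ^ 2) * L + 4 * M ^ 2 * (exp (α * u ξ t) * L) := by ring
      _ ≤ K + 4 * M ^ 2 * Q := by gcongr

end Sys

namespace WarpedBerger
variable {T : ℝ} {f g ρ : ℝ → ℝ → ℝ}

lemma sms (W : WarpedBerger T f g ρ) : Sm T f ∧ Sm T g ∧ Sm T ρ := by
  have h : ∀ ξ t : ℝ, 0 < t → t < T → ContDiffAt ℝ (⊤ : ℕ∞)
      (fun p : ℝ × ℝ => (f p.1 p.2, g p.1 p.2, ρ p.1 p.2)) (ξ, t) := by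
    intro ξ t h0 h1
    exact W.smooth.contDiffAt (prod_mem_nhds univ_mem (Ico_mem_nhds h0 h1))
  exact ⟨⟨fun ξ t h0 h1 => (h ξ t h0 h1).fst, W.f_per⟩,
    ⟨fun ξ t h0 h1 => (h ξ t h0 h1).snd.fst, W.g_per⟩,
    ⟨fun ξ t h0 h1 => (h ξ t h0 h1).snd.snd, W.ρ_per⟩⟩

lemma Dlog {φ : ℝ → ℝ → ℝ} (hφ : Sm T φ) (hp : ∀ ξ t, 0 < t → t < T → 0 < φ ξ t) {ξ t : ℝ}
    (h0 : 0 < t) (h1 : t < T) :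
    Ds ρ (fun x t => Real.log (φ x t)) ξ t = Ds ρ φ ξ t / φ ξ t := by
  have h := (((hφ.hx (ξ := ξ) h0 h1).differentiableAt.hasDerivAt).log (hp ξ t h0 h1).ne').deriv
  rw [Ds, pd1, h, Ds, pd1]
  ring

lemma Tlog {φ : ℝ → ℝ → ℝ} (hφ : Sm T φ) (hp : ∀ ξ t, 0 < t → t < T → 0 < φ ξ t) {ξ t : ℝ}
    (h0 : 0 < t) (h1 : t < T) :
    pdt (fun x t => Real.log (φ x t)) ξ t = pdt φ ξ t / φ ξ t :=
  (((hφ.ht (ξ := ξ) h0 h1).differentiableAt.hasDerivAt).log (hp ξ t h0 h1).ne').deriv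

lemma DDlog {φ : ℝ → ℝ → ℝ} (hφ : Sm T φ) (hp : ∀ ξ t, 0 < t → t < T → 0 < φ ξ t)
    (hρ : Sm T ρ) (hq : ∀ ξ t, 0 < t → t < T → 0 < ρ ξ t) {ξ t : ℝ}
    (h0 : 0 < t) (h1 : t < T) :
    Ds ρ (Ds ρ (fun x t => Real.log (φ x t))) ξ t
      = Ds ρ (Ds ρ φ) ξ t / φ ξ t - (Ds ρ φ ξ t / φ ξ t) ^ 2 := by
  rw [Sys.D_congr (ψ := fun x t => Ds ρ φ x t / φ x t) fun x => Dlog hφ hp h0 h1]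
  have a := ((hφ.sm_Ds hρ hq).hx (ξ := ξ) h0 h1).differentiableAt.hasDerivAt
  have b := (hφ.hx (ξ := ξ) h0 h1).differentiableAt.hasDerivAt
  have h := (a.div b (hp ξ t h0 h1).ne').deriv
  have h' : pd1 (fun x t => Ds ρ φ x t / φ x t) ξ t
    = (pd1 (Ds ρ φ) ξ t * φ ξ t - Ds ρ φ ξ t * pd1 φ ξ t) / φ ξ t ^ 2 := h
  have h2 := hp ξ t h0 h1
  have h3 := hq ξ t h0 h1
  rw [Ds, h', Ds, Ds]
  field_simp

lemma Dsub {φ ψ : ℝ → ℝ → ℝ} (hφ : Sm T φ) (hψ : Sm T ψ) {ξ t : ℝ} (h0 : 0 < t) (h1 : t < T) :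
    Ds ρ (fun x t => φ x t - ψ x t) ξ t = Ds ρ φ ξ t - Ds ρ ψ ξ t := by
  have h := ((hφ.hx (ξ := ξ) h0 h1).differentiableAt.hasDerivAt.sub
    (hψ.hx (ξ := ξ) h0 h1).differentiableAt.hasDerivAt).deriv
  have h' : pd1 (fun x t => φ x t - ψ x t) ξ t = pd1 φ ξ t - pd1 ψ ξ t := h
  rw [Ds, h', Ds, Ds, sub_div]

lemma Tsub {φ ψ : ℝ → ℝ → ℝ} (hφ : Sm T φ) (hψ : Sm T ψ) {ξ t : ℝ} (h0 : 0 < t) (h1 : t < T) :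
    pdt (fun x t => φ x t - ψ x t) ξ t = pdt φ ξ t - pdt ψ ξ t :=
  ((hφ.ht (ξ := ξ) h0 h1).differentiableAt.hasDerivAt.sub
    (hψ.ht (ξ := ξ) h0 h1).differentiableAt.hasDerivAt).deriv

lemma facts (W : WarpedBerger T f g ρ) {ξ t : ℝ} (h0 : 0 < t) (h1 : t < T) :
    Ds ρ (fun x t => Real.log (f x t) - Real.log (g x t)) ξ t
      = Ds ρ f ξ t / f ξ t - Ds ρ g ξ t / g ξ t ∧
    Ds ρ (Ds ρ (fun x t => Real.log (f x t) - Real.log (g x t))) ξ t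
      = (Ds ρ (Ds ρ f) ξ t / f ξ t - (Ds ρ f ξ t / f ξ t) ^ 2)
        - (Ds ρ (Ds ρ g) ξ t / g ξ t - (Ds ρ g ξ t / g ξ t) ^ 2) ∧
    pdt (fun x t => Real.log (f x t) - Real.log (g x t)) ξ t
      = pdt f ξ t / f ξ t - pdt g ξ t / g ξ t := by
  obtain ⟨sf, sg, sρ⟩ := W.sms
  have pf : ∀ ξ t, 0 < t → t < T → 0 < f ξ t := fun ξ t h0 h1 => W.f_pos ξ t h0.le h1
  have pg : ∀ ξ t, 0 < t → t < T → 0 < g ξ t := fun ξ t h0 h1 => W.g_pos ξ t h0.le h1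
  have pρ : ∀ ξ t, 0 < t → t < T → 0 < ρ ξ t := fun ξ t h0 h1 => W.ρ_pos ξ t h0.le h1
  have lf := sf.log pf
  have lg := sg.log pg
  refine ⟨?_, ?_, ?_⟩
  · rw [Dsub lf lg h0 h1, Dlog sf pf h0 h1, Dlog sg pg h0 h1]
  · rw [Sys.D_congr (ψ := fun x t => Ds ρ (fun x t => Real.log (f x t)) x t
        - Ds ρ (fun x t => Real.log (g x t)) x t) fun x => Dsub lf lg h0 h1,
      Dsub (lf.sm_Ds sρ pρ) (lg.sm_Ds sρ pρ) h0 h1, DDlog sf pf sρ pρ h0 h1,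
      DDlog sg pg sρ pρ h0 h1]
  · rw [Tsub lf lg h0 h1, Tlog sf pf h0 h1, Tlog sg pg h0 h1]

lemma sys (W : WarpedBerger T f g ρ) :
    Sys T ρ (fun x t => Real.log (f x t)) (fun x t => Real.log (f x t) - Real.log (g x t)) := by
  obtain ⟨sf, sg, sρ⟩ := W.sms
  have pf : ∀ ξ t, 0 < t → t < T → 0 < f ξ t := fun ξ t h0 h1 => W.f_pos ξ t h0.le h1
  have pg : ∀ ξ t, 0 < t → t < T → 0 < g ξ t := fun ξ t h0 h1 => W.g_pos ξ t h0.le h1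
  have pρ : ∀ ξ t, 0 < t → t < T → 0 < ρ ξ t := fun ξ t h0 h1 => W.ρ_pos ξ t h0.le h1
  have lf := sf.log pf
  have lg := sg.log pg
  have e4 : ∀ ξ t, 0 < t → t < T → exp (4 * (Real.log (f ξ t) - Real.log (g ξ t))
      - 2 * Real.log (f ξ t)) = f ξ t ^ 2 / g ξ t ^ 4 := by
    intro ξ t h0 h1
    have a := pf ξ t h0 h1
    have b := pg ξ t h0 h1
    rw [← Real.exp_log (show 0 < f ξ t ^ 2 / g ξ t ^ 4 by positivity),
      Real.log_div (by positivity) (by positivity), Real.log_pow, Real.log_pow]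
    congr 1; push_cast; ring
  have e2 : ∀ ξ t, 0 < t → t < T → exp (2 * (Real.log (f ξ t) - Real.log (g ξ t))
      - 2 * Real.log (f ξ t)) = 1 / g ξ t ^ 2 := by
    intro ξ t h0 h1
    have b := pg ξ t h0 h1
    rw [← Real.exp_log (show 0 < 1 / g ξ t ^ 2 by positivity),
      Real.log_div (by positivity) (by positivity), Real.log_pow, Real.log_one]
    congr 1; push_cast; ring
  refine ⟨W.T_pos, sρ, pρ, lf, lf.sub lg, ?_, ?_, ?_⟩
  · intro ξ t h0 h1
    obtain ⟨d1, d2, d3⟩ := W.facts (ξ := ξ) h0 h1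
    have a := pf ξ t h0 h1
    have b := pg ξ t h0 h1
    rw [e4 ξ t h0 h1, Hop, d1, Tlog sf pf h0 h1, DDlog sf pf sρ pρ h0 h1, Dlog sf pf h0 h1,
      W.eq_f ξ t h0 h1]
    field_simp
    ring
  · intro ξ t h0 h1
    obtain ⟨d1, d2, d3⟩ := W.facts (ξ := ξ) h0 h1
    have a := pf ξ t h0 h1
    have b := pg ξ t h0 h1
    rw [e4 ξ t h0 h1, e2 ξ t h0 h1, Hop, d1, d2, d3, Dlog sf pf h0 h1,
      W.eq_f ξ t h0 h1, W.eq_g ξ t h0 h1]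
    field_simp
    ring
  · intro ξ t h0 h1
    obtain ⟨d1, d2, d3⟩ := W.facts (ξ := ξ) h0 h1
    have a := pf ξ t h0 h1
    have b := pg ξ t h0 h1
    have c := pρ ξ t h0 h1
    have h := W.eq_ρ ξ t h0 h1
    rw [Tlog sρ pρ h0 h1, div_eq_iff c.ne'] at h
    rw [h, d1, d2, DDlog sf pf sρ pρ h0 h1, Dlog sf pf h0 h1]
    ring

end WarpedBerger

/-- Under Assumption B, for every sufficiently small `δ ∈ (0,1)` there
exist `t_δ ∈ [0,T)` and `C < ∞` such that on the neck-like region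
`{t_δ < t < T, f ≤ δ, f_ss ≥ 0}` one has
`(T−t)|κ₀₁| ≤ C/|log(T−t)|` and `(T−t)|κ₀₂| ≤ C/|log(T−t)|`. -/
theorem neck_curvature_smallness (T : ℝ) (f g ρ : ℝ → ℝ → ℝ)
    (sol : AssumptionB T f g ρ) :
    ∃ δ₀ : ℝ, 0 < δ₀ ∧ δ₀ ≤ 1 ∧ ∀ δ : ℝ, 0 < δ → δ < δ₀ →
      ∃ tδ C : ℝ, 0 ≤ tδ ∧ tδ < T ∧
        ∀ ξ t : ℝ, tδ < t → t < T → f ξ t ≤ δ → 0 ≤ Ds ρ (Ds ρ f) ξ t →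
          (T - t) * |k01 ρ f ξ t| ≤ C / |Real.log (T - t)| ∧
          (T - t) * |k02 ρ g ξ t| ≤ C / |Real.log (T - t)| := by
  have W : WarpedBerger T f g ρ := sol.toAssumptionA.toWarpedBerger
  have hT := W.T_pos
  obtain ⟨D, C, D0, C0, hDC⟩ := W.sys.S9
  obtain ⟨sf, sg, sρ⟩ := W.sms
  have pf : ∀ ξ t, 0 < t → t < T → 0 < f ξ t := fun ξ t h0 h1 => W.f_pos ξ t h0.le h1
  have pg : ∀ ξ t, 0 < t → t < T → 0 < g ξ t := fun ξ t h0 h1 => W.g_pos ξ t h0.le h1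
  have pρ : ∀ ξ t, 0 < t → t < T → 0 < ρ ξ t := fun ξ t h0 h1 => W.ρ_pos ξ t h0.le h1
  refine ⟨exp (-D), exp_pos _, by rw [exp_le_one_iff]; linarith, ?_⟩
  intro δ hδ hδ0
  refine ⟨max (T / 2) (T - 1 / 2), C, le_max_of_le_left (by linarith),
    max_lt (by linarith) (by linarith), ?_⟩
  intro ξ t ht hT1 hf hss
  have ht2 : T / 2 < t := lt_of_le_of_lt (le_max_left _ _) ht
  have ht3 : T - 1 / 2 < t := lt_of_le_of_lt (le_max_right _ _) ht
  have h0 : 0 < t := by linarith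
  have a := pf ξ t h0 hT1
  have b := pg ξ t h0 hT1
  obtain ⟨d1, d2, -⟩ := W.facts (ξ := ξ) h0 hT1
  have e1 : Ds ρ (Ds ρ (fun x t => Real.log (f x t))) ξ t
      + Ds ρ (fun x t => Real.log (f x t)) ξ t ^ 2 = Ds ρ (Ds ρ f) ξ t / f ξ t := by
    rw [WarpedBerger.DDlog sf pf sρ pρ h0 hT1, WarpedBerger.Dlog sf pf h0 hT1]
    ring
  have hlogf : Real.log (f ξ t) ≤ -D := by
    rw [Real.log_le_iff_le_exp a]
    linarith
  obtain ⟨r1, r2⟩ := hDC ξ t ht2.le hT1 (by linarith) hlogf (by rw [e1]; positivity)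
  rw [e1] at r1
  have e2 : Ds ρ (Ds ρ (fun x t => Real.log (f x t))) ξ t
      - Ds ρ (Ds ρ (fun x t => Real.log (f x t) - Real.log (g x t))) ξ t
      + (Ds ρ (fun x t => Real.log (f x t)) ξ t
        - Ds ρ (fun x t => Real.log (f x t) - Real.log (g x t)) ξ t) ^ 2
      = Ds ρ (Ds ρ g) ξ t / g ξ t := by
    rw [d1, d2, WarpedBerger.DDlog sf pf sρ pρ h0 hT1, WarpedBerger.Dlog sf pf h0 hT1]
    ring
  rw [e2] at r2
  have hl : 0 < |Real.log (T - t)| :=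
    abs_pos.mpr (Real.log_neg (by linarith) (by linarith)).ne
  rw [k01, k02, neg_div, neg_div, abs_neg, abs_neg]
  exact ⟨(le_div_iff₀ hl).mpr r1, (le_div_iff₀ hl).mpr r2⟩
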